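/- The relation ◁ on Ramsey measures on a cardinal κ, defined by U ◁ W iff U ∈ N_W, is transitive and well-founded. -/

import Mathlib

noncomputable section

namespace MPaper

open ZFSet

attribute [local instance] Classical.propDecidable

/-! ### Basic set-theoretic vocabulary over `ZFSet` -/

/-- The (external) cardinality of a ZFC set. -/
def zcard (x : ZFSet) : Cardinal := Cardinal.mk x.toSet

/-- `x` is a von Neumann ordinal: a transitive set of transitive sets. -/
def IsOrd (x : ZFSet) : Prop := x.IsTransitive ∧ ∀ y ∈ x, ZFSet.IsTransitive y

/-- `κ` is a cardinal: an ordinal not equinumerous with any of its members. -/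
def IsCard (κ : ZFSet) : Prop := IsOrd κ ∧ ∀ α ∈ κ, zcard α < zcard κ

/-- The ordinal `κ⁺`, the cardinal successor of `κ`. -/
def cardSuccOrd (κ : ZFSet) : Ordinal := (Order.succ (zcard κ)).ord

/-- `f` is a set-coded function with domain `d` (a set of Kuratowski pairs). -/
def IsZFunc (d f : ZFSet) : Prop :=
  (∀ p ∈ f, ∃ a ∈ d, ∃ b, p = ZFSet.pair a b) ∧ ∀ a ∈ d, ∃! b, ZFSet.pair a b ∈ f

/-- Application of a set-coded function. -/
def fapp (f a : ZFSet) : ZFSet :=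
  ⋃₀ (ZFSet.sep (fun b => ZFSet.pair a b ∈ f) (⋃₀ (⋃₀ f)))

/-- `f` maps `d` into `y`. -/
def MapsInto (f d y : ZFSet) : Prop := ∀ a ∈ d, fapp f a ∈ y

/-- `f` maps `d` onto `y`. -/
def SurjOnto (f d y : ZFSet) : Prop := MapsInto f d y ∧ ∀ b ∈ y, ∃ a ∈ d, fapp f a = b

/-- `f` is injective on `d`. -/
def InjOnZ (f d : ZFSet) : Prop := ∀ a ∈ d, ∀ b ∈ d, fapp f a = fapp f b → a = b

/-- `f` is a bijection from `d` onto `y`. -/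
def IsBij (f d y : ZFSet) : Prop := IsZFunc d f ∧ SurjOnto f d y ∧ InjOnZ f d

/-- The tail `κ ∖ α = {ξ ∈ κ | α ≤ ξ}` (for ordinals `α ∈ κ`). -/
def tailSet (κ α : ZFSet) : ZFSet := ZFSet.sep (fun ξ => ξ ∉ α) κ

/-- The relative complement `κ ∖ A`. -/
def compl (κ A : ZFSet) : ZFSet := ZFSet.sep (fun ξ => ξ ∉ A) κ

/-! ### First-order satisfaction in ∈-structures -/

/-- First order formulas in the language of set theory, with variables indexed by `ℕ`. -/
inductive Fml : Type
  | mem : ℕ → ℕ → Fml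
  | eq : ℕ → ℕ → Fml
  | impl : Fml → Fml → Fml
  | neg : Fml → Fml
  | all : ℕ → Fml → Fml

/-- Tarskian satisfaction of a formula in the ∈-structure with domain `D`. -/
def Sat (D : Set ZFSet) : Fml → (ℕ → ZFSet) → Prop
  | .mem i j, v => v i ∈ v j
  | .eq i j, v => v i = v j
  | .impl φ ψ, v => Sat D φ v → Sat D ψ v
  | .neg φ, v => ¬ Sat D φ v
  | .all n φ, v => ∀ x ∈ D, Sat D φ (Function.update v n x)

/-- `D` is an elementary substructure of `E` (as ∈-structures). -/
def ElemSub (D E : Set ZFSet) : Prop :=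
  D ⊆ E ∧ ∀ (φ : Fml) (v : ℕ → ZFSet), (∀ n, v n ∈ D) → (Sat D φ v ↔ Sat E φ v)

/-- `r` is a well-ordering of `x` (coded as a set of Kuratowski pairs). -/
def IsWellOrderOn (x r : ZFSet) : Prop :=
  (∀ p ∈ r, ∃ a ∈ x, ∃ b ∈ x, p = ZFSet.pair a b) ∧
  (∀ a ∈ x, ∀ b ∈ x, a = b ∨ ZFSet.pair a b ∈ r ∨ ZFSet.pair b a ∈ r) ∧
  (∀ a ∈ x, ∀ b ∈ x, ∀ c ∈ x,
    ZFSet.pair a b ∈ r → ZFSet.pair b c ∈ r → ZFSet.pair a c ∈ r) ∧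
  (∀ a ∈ x, ZFSet.pair a a ∉ r) ∧
  (∀ S : Set ZFSet, S ⊆ x.toSet → S.Nonempty → ∃ a ∈ S, ∀ b ∈ S, ZFSet.pair b a ∉ r)

/-- A transitive model of `ZFC⁻` (ZFC minus power set): a transitive set closed under
pairing and union, containing `ω`, satisfying the separation and collection schemes for
first-order formulas, and choice in the guise of the well-ordering principle.
(Extensionality and foundation hold automatically in transitive sets.) -/
def IsTransModel (M : ZFSet) : Prop :=
  M.IsTransitive ∧
  ZFSet.omega ∈ M ∧
  (∀ x ∈ M, ∀ y ∈ M, ({x, y} : ZFSet) ∈ M) ∧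
  (∀ x ∈ M, (⋃₀ x : ZFSet) ∈ M) ∧
  (∀ (φ : Fml) (v : ℕ → ZFSet), (∀ n, v n ∈ M) → ∀ a ∈ M,
    ∃ b ∈ M, ∀ x, x ∈ b ↔ x ∈ a ∧ Sat M.toSet φ (Function.update v 0 x)) ∧
  (∀ (φ : Fml) (v : ℕ → ZFSet), (∀ n, v n ∈ M) → ∀ a ∈ M,
    (∀ x ∈ a, ∃ y ∈ M, Sat M.toSet φ (Function.update (Function.update v 0 x) 1 y)) →
    ∃ b ∈ M, ∀ x ∈ a, ∃ y ∈ b, Sat M.toSet φ (Function.update (Function.update v 0 x) 1 y)) ∧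
  (∀ x ∈ M, ∃ r ∈ M, IsWellOrderOn x r)

/-! ### Weak κ-models, κ-models, M-ultrafilters -/

/-- A weak `κ`-model: a transitive model of ZFC⁻ of size `κ` with `κ ∈ M`. -/
def IsWeakModel (κ M : ZFSet) : Prop :=
  IsTransModel M ∧ κ ∈ M ∧ zcard M = zcard κ

/-- `M` is closed under `<κ`-sequences (of its elements). -/
def SeqClosed (κ M : ZFSet) : Prop :=
  ∀ γ ∈ κ, ∀ f : ZFSet, IsZFunc γ f → (∀ a ∈ γ, fapp f a ∈ M) → f ∈ M

/-- A `κ`-model: a weak `κ`-model closed under `<κ`-sequences. -/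
def IsKappaModel (κ M : ZFSet) : Prop := IsWeakModel κ M ∧ SeqClosed κ M

/-- `U` is an `M`-ultrafilter on `κ`: `⟨M, ∈, U⟩` thinks `U` is a normal ultrafilter on `κ`
containing all tail sets. -/
def IsMUltrafilter (κ M U : ZFSet) : Prop :=
  (∀ A ∈ U, A ∈ M ∧ A ⊆ κ) ∧
  (∀ α ∈ κ, tailSet κ α ∈ U) ∧
  (∅ : ZFSet) ∉ U ∧
  (∀ A ∈ U, ∀ B ∈ U, A ∩ B ∈ U) ∧
  (∀ A ∈ U, ∀ B, B ∈ M → B ⊆ κ → A ⊆ B → B ∈ U) ∧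
  (∀ B, B ∈ M → B ⊆ κ → B ∈ U ∨ compl κ B ∈ U) ∧
  (∀ f ∈ M, IsZFunc κ f → ZFSet.sep (fun ξ => fapp f ξ ∈ ξ) κ ∈ U →
    ∃ γ ∈ κ, ZFSet.sep (fun ξ => fapp f ξ = γ) κ ∈ U)

/-- `U` is weakly amenable for `M`: for every `X ∈ M` of size at most `κ` in `M`,
the intersection `X ∩ U` belongs to `M`. -/
def WeaklyAmenable (κ M U : ZFSet) : Prop :=
  ∀ X ∈ M, (∃ f ∈ M.toSet, IsZFunc κ f ∧ ∀ y ∈ X, ∃ ξ ∈ κ, fapp f ξ = y) →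
    X ∩ U ∈ M

/-- `U` is `ω₁`-intersecting: every countable collection of its members has a common element. -/
def OmegaOneIntersecting (U : ZFSet) : Prop :=
  ∀ s : ℕ → ZFSet, (∀ n, s n ∈ U) → ∃ x, ∀ n, x ∈ s n

/-- `M` contains (its version of) `V_κ`, i.e. the set of all sets of rank `< κ`. -/
def HasVkappa (κ M : ZFSet) : Prop :=
  ∃ v ∈ M.toSet, ∀ x, x ∈ v ↔ ZFSet.rank x < ZFSet.rank κ

/-! ### Small universe measures and the associated models `M_U`, `N_U` -/

/-- `M` is the minimal model associated to `U` (the collection of Mostowski collapses of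
well-founded relations on `κ` coded by sets in `U` and their complements): a weak `κ`-model
with `V_κ ∈ M` for which `U` is an `M`-ultrafilter, contained in every transitive
ZFC⁻-model `M'` with `κ ∈ M'` for which `U` is an `M'`-ultrafilter. -/
def IsMUModel (κ U M : ZFSet) : Prop :=
  IsWeakModel κ M ∧ HasVkappa κ M ∧ IsMUltrafilter κ M U ∧
  ∀ M', IsTransModel M' → κ ∈ M' → IsMUltrafilter κ M' U → M ⊆ M'

/-- A small universe measure on `κ`: a set `U` of subsets of `κ` of size `κ` whose associated
minimal model `M_U` exists (is a weak `κ`-model with `V_κ ∈ M_U` and `U` an `M_U`-ultrafilter). -/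
def IsSUMeasure (κ U : ZFSet) : Prop :=
  zcard U = zcard κ ∧ (∀ A ∈ U, A ⊆ κ) ∧ ∃ M, IsMUModel κ U M

/-- The minimal model `M_U` associated to a small universe measure `U`. -/
def MU (κ U : ZFSet) : ZFSet :=
  if h : ∃ M, IsMUModel κ U M then h.choose else ∅

/-- `j : M → N` is (up to isomorphism) the ultrapower embedding of `M` by the
`M`-ultrafilter `U` on `κ`, with `N` transitive (so the ultrapower is well-founded):
`j` is elementary, every element of `N` has the form `j(f)(κ)` for `f : κ → M` in `M`,
and `U` is the `M`-ultrafilter derived from `j` with seed `κ`. -/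
def IsUltrapowerEmb (κ M U N : ZFSet) (j : ZFSet → ZFSet) : Prop :=
  N.IsTransitive ∧
  (∀ x ∈ M, j x ∈ N) ∧
  (∀ (φ : Fml) (v : ℕ → ZFSet), (∀ n, v n ∈ M) →
    (Sat M.toSet φ v ↔ Sat N.toSet φ (fun n => j (v n)))) ∧
  (∀ a ∈ N, ∃ f ∈ M.toSet, IsZFunc κ f ∧ MapsInto f κ M ∧ fapp (j f) κ = a) ∧
  (∀ A ∈ M, A ⊆ κ → (A ∈ U ↔ κ ∈ j A))

/-- The ultrapower of `M_U` by `U` is well-founded. -/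
def UltrapowerWF (κ U : ZFSet) : Prop :=
  ∃ (N : ZFSet) (j : ZFSet → ZFSet), IsUltrapowerEmb κ (MU κ U) U N j

/-- A choice of transitive collapse of the ultrapower of `M_U` by `U`, with its embedding. -/
def upData (κ U : ZFSet) : ZFSet × (ZFSet → ZFSet) :=
  if h : ∃ p : ZFSet × (ZFSet → ZFSet), IsUltrapowerEmb κ (MU κ U) U p.1 p.2
  then h.choose else (∅, id)

/-- `N_U`: the transitive collapse of the ultrapower of `M_U` by `U` (when well-founded). -/
def NU (κ U : ZFSet) : ZFSet := (upData κ U).1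

/-- The ultrapower embedding `j_U : M_U → N_U`. -/
def jU (κ U : ZFSet) : ZFSet → ZFSet := (upData κ U).2

/-- `M_U⋆ = V_{j(κ)}^{N_U}`, the rank-initial segment of `N_U` below `j_U(κ)`. -/
def MUstar (κ U : ZFSet) : ZFSet :=
  ZFSet.sep (fun x => ZFSet.rank x < ZFSet.rank (jU κ U κ)) (NU κ U)

/-! ### Hereditary size, `H_{κ⁺}`, elementarity -/

/-- `x` has hereditary size at most `κ`. -/
def HeredLE (κ : ZFSet) : ZFSet → Prop :=
  WellFounded.fix ZFSet.mem_wf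
    (fun x ih => zcard x ≤ zcard κ ∧ ∀ y, ∀ h : y ∈ x, ih y h)

/-- The class `H_{κ⁺}` of sets of hereditary size at most `κ`. -/
def Hclass (κ : ZFSet) : Set ZFSet := { x | HeredLE κ x }

/-! ### The measures witnessing Ramsey and Ramsey-like cardinals -/

/-- A Ramsey measure on `κ`: a weakly amenable `ω₁`-intersecting small universe measure. -/
def IsRamseyMeasure (κ U : ZFSet) : Prop :=
  IsSUMeasure κ U ∧ WeaklyAmenable κ (MU κ U) U ∧ OmegaOneIntersecting U

/-- A strong Ramsey measure on `κ`: a weakly amenable small universe measure whose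
minimal model `M_U` is a `κ`-model. -/
def IsStrongRamseyMeasure (κ U : ZFSet) : Prop :=
  IsSUMeasure κ U ∧ WeaklyAmenable κ (MU κ U) U ∧ SeqClosed κ (MU κ U)

/-- A super Ramsey measure on `κ`: a strong Ramsey measure with `M_U ≺ H_{κ⁺}`. -/
def IsSuperRamseyMeasure (κ U : ZFSet) : Prop :=
  IsStrongRamseyMeasure κ U ∧ ElemSub (MU κ U).toSet (Hclass κ)

/-- `I` certifies `U`: `I` is an unbounded subset of `κ` and the sets in `U` are exactly
the subsets of `κ` in `M_U` containing a tail of `I`. -/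
def Certifies (κ U : ZFSet) (I : Set ZFSet) : Prop :=
  (∀ ξ ∈ I, ξ ∈ κ) ∧ (∀ α ∈ κ, ∃ ξ ∈ I, ξ ∉ α) ∧
  ∀ X ∈ (MU κ U).toSet, X ⊆ κ →
    (X ∈ U ↔ ∃ α ∈ κ.toSet, ∀ ξ ∈ I, ξ ∉ α → ξ ∈ X)

/-- A certified Ramsey measure on `κ`: a weakly amenable small universe measure which is
certified by some unbounded `I ⊆ κ`. -/
def IsCertifiedRamseyMeasure (κ U : ZFSet) : Prop :=
  IsSUMeasure κ U ∧ WeaklyAmenable κ (MU κ U) U ∧ ∃ I : Set ZFSet, Certifies κ U I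

/-! ### Relativized (internal) versions of the measure predicates -/

/-- `ω₁`-intersecting from the point of view of the transitive model `N`: every
`ω`-sequence of members of `U` lying in `N` has a common element. -/
def OmegaOneIntersectingIn (N U : ZFSet) : Prop :=
  ∀ f ∈ N.toSet, IsZFunc ZFSet.omega f → (∀ n ∈ ZFSet.omega, fapp f n ∈ U) →
    ∃ x, ∀ n ∈ ZFSet.omega, x ∈ fapp f n

/-- `N ⊨ U is a Ramsey measure on κ`, for a transitive ZFC⁻-model `N`: all components are
absolute except `ω₁`-intersectingness, which is evaluated using sequences in `N`. -/
def RamseyMeasureIn (N κ U : ZFSet) : Prop :=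
  U ∈ N ∧ IsSUMeasure κ U ∧ WeaklyAmenable κ (MU κ U) U ∧ OmegaOneIntersectingIn N U

/-- `N ⊨ U is a strong Ramsey measure on κ`: closure of `M_U` under `<κ`-sequences is
evaluated using the sequences lying in `N`. -/
def StrongRamseyMeasureIn (N κ U : ZFSet) : Prop :=
  U ∈ N ∧ IsSUMeasure κ U ∧ WeaklyAmenable κ (MU κ U) U ∧
  ∀ f ∈ N.toSet, ∀ γ ∈ κ, IsZFunc γ f → (∀ a ∈ γ, fapp f a ∈ MU κ U) → f ∈ MU κ U

/-- The class `H_{κ⁺}` as computed in `N`. -/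
def HclassIn (N κ : ZFSet) : Set ZFSet := { x | x ∈ N ∧ HeredLE κ x }

/-- `N ⊨ U is a super Ramsey measure on κ`. -/
def SuperRamseyMeasureIn (N κ U : ZFSet) : Prop :=
  StrongRamseyMeasureIn N κ U ∧ ElemSub (MU κ U).toSet (HclassIn N κ)

/-- `N ⊨ U is a certified Ramsey measure on κ` (the certifying set is required to lie in `N`). -/
def CertifiedRamseyMeasureIn (N κ U : ZFSet) : Prop :=
  U ∈ N ∧ IsSUMeasure κ U ∧ WeaklyAmenable κ (MU κ U) U ∧
  ∃ I ∈ N.toSet, Certifies κ U I.toSet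

/-! ### Goodness, witness collections, and the M-order -/

/-- `U` is `A`-good: `A ∈ M_U`. -/
def AGood (κ A U : ZFSet) : Prop := A ∈ MU κ U

/-- A witness collection of `Pm`-measures on `κ`: a collection of `Pm`-measures containing
an `A`-good one for every `A ⊆ κ`. -/
def IsWitness (Pm : ZFSet → ZFSet → Prop) (κ : ZFSet) (𝒰 : Set ZFSet) : Prop :=
  (∀ U ∈ 𝒰, Pm κ U) ∧ ∀ A : ZFSet, A ⊆ κ → ∃ U ∈ 𝒰, AGood κ A U

/-- The M-order on witness collections of `Pm`-measures on `κ`; `PmIn N κ U` is the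
relativization `N ⊨ U is a Pm-measure on κ`.  `MOrder Pm PmIn κ 𝒰 𝒲` says `𝒰 ◁ 𝒲`. -/
def MOrder (Pm : ZFSet → ZFSet → Prop) (PmIn : ZFSet → ZFSet → ZFSet → Prop)
    (κ : ZFSet) (𝒰 𝒲 : Set ZFSet) : Prop :=
  IsWitness Pm κ 𝒰 ∧ IsWitness Pm κ 𝒲 ∧
  (∀ W ∈ 𝒲, ∀ A ∈ (NU κ W).toSet, A ⊆ κ →
    ∃ U ∈ 𝒰, U ∈ NU κ W ∧ AGood κ A U ∧ PmIn (NU κ W) κ U) ∧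
  (∀ U ∈ 𝒰, ∃ W ∈ 𝒲, U ∈ NU κ W)

/-! ### Ranks -/

/-- The rank of a point in an arbitrary binary relation (`0` at non-accessible points). -/
def relRank {X : Type*} (r : X → X → Prop) (x : X) : Ordinal :=
  if h : Acc r x then h.rank else 0

/-- The M-rank `o_Pm(κ)`: the strict supremum of the M-ranks of all witness collections of
`Pm`-measures on `κ` (and `0` if there are none). -/
def oRank (Pm : ZFSet → ZFSet → Prop) (PmIn : ZFSet → ZFSet → ZFSet → Prop)
    (κ : ZFSet) : Ordinal :=
  sSup { o : Ordinal |
    ∃ 𝒰 : Set ZFSet, IsWitness Pm κ 𝒰 ∧ o = relRank (MOrder Pm PmIn κ) 𝒰 + 1 }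

/-- `N ⊨ o_Pm(κ) ≥ α`, defined by the recursion: for every `A ⊆ κ` in `N` and every `β < α`
there is an `A`-good `Pm`-measure `W` in `N` (in the sense of `N`) whose ultrapower satisfies
`o_Pm(κ) ≥ β`. -/
def oGEin (PmIn : ZFSet → ZFSet → ZFSet → Prop) (κ : ZFSet) : Ordinal → ZFSet → Prop :=
  WellFounded.fix wellFounded_lt fun α ih N =>
    ∀ A ∈ N.toSet, A ⊆ κ → ∀ β, ∀ h : β < α,
      ∃ W ∈ N.toSet, PmIn N κ W ∧ AGood κ A W ∧ ih β h (NU κ W)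

/-- `N ⊨ o_Pm(κ) = α`. -/
def oEQin (PmIn : ZFSet → ZFSet → ZFSet → Prop) (κ : ZFSet) (α : Ordinal) (N : ZFSet) : Prop :=
  oGEin PmIn κ α N ∧ ¬ oGEin PmIn κ (α + 1) N

/-! ### The M-order and M-rank relativized to a model `ℳ` -/

/-- A witness collection (coded as a set) of `Pm`-measures in the sense of the model `ℳ`. -/
def IsWitnessIn (PmIn : ZFSet → ZFSet → ZFSet → Prop) (ℳ κ 𝒰 : ZFSet) : Prop :=
  𝒰 ∈ ℳ ∧ (∀ U ∈ 𝒰, PmIn ℳ κ U) ∧ ∀ A ∈ ℳ.toSet, A ⊆ κ → ∃ U ∈ 𝒰.toSet, AGood κ A U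

/-- The M-order on witness collections as computed in `ℳ`. -/
def MOrderIn (PmIn : ZFSet → ZFSet → ZFSet → Prop) (ℳ κ : ZFSet) (𝒰 𝒲 : ZFSet) : Prop :=
  IsWitnessIn PmIn ℳ κ 𝒰 ∧ IsWitnessIn PmIn ℳ κ 𝒲 ∧
  (∀ W ∈ 𝒲, ∀ A ∈ (NU κ W).toSet, A ⊆ κ →
    ∃ U ∈ 𝒰.toSet, U ∈ NU κ W ∧ AGood κ A U ∧ PmIn (NU κ W) κ U) ∧
  (∀ U ∈ 𝒰, ∃ W ∈ 𝒲.toSet, U ∈ NU κ W)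

/-- The M-rank `o_Pm(κ)` as computed in `ℳ`. -/
def oRankIn (PmIn : ZFSet → ZFSet → ZFSet → Prop) (ℳ κ : ZFSet) : Ordinal :=
  sSup { o : Ordinal |
    ∃ 𝒰 : ZFSet, IsWitnessIn PmIn ℳ κ 𝒰 ∧ o = relRank (MOrderIn PmIn ℳ κ) 𝒰 + 1 }

/-! ### Practical models, cover and approximation properties -/

/-- `ℳ` is practical for `κ`: a transitive ZFC⁻-model containing `κ` in which
`V_{κ+3}` exists. -/
def Practical (κ ℳ : ZFSet) : Prop :=
  IsTransModel ℳ ∧ κ ∈ ℳ ∧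
  ∃ v ∈ ℳ.toSet, ∀ x, x ∈ v ↔ (x ∈ ℳ ∧ ZFSet.rank x < ZFSet.rank κ + 3)

/-- `x` has size less than `δ` as witnessed inside the class `D`:
some `f ∈ D` injects `x` into an ordinal `γ ∈ δ`. -/
def SizeLTin (D : Set ZFSet) (x δ : ZFSet) : Prop :=
  ∃ γ ∈ δ.toSet, ∃ f ∈ D, IsZFunc x f ∧ MapsInto f x γ ∧ InjOnZ f x

/-- The pair `D ⊆ D'` has the `δ`-cover property. -/
def CoverProperty (δ : ZFSet) (D D' : Set ZFSet) : Prop :=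
  ∀ X ∈ D', X.toSet ⊆ D → SizeLTin D' X δ →
    ∃ Y ∈ D, X ⊆ Y ∧ SizeLTin D Y δ

/-- The pair `D ⊆ D'` has the `δ`-approximation property. -/
def ApproxProperty (δ : ZFSet) (D D' : Set ZFSet) : Prop :=
  ∀ X ∈ D', X.toSet ⊆ D → (∀ x ∈ D, SizeLTin D x δ → X ∩ x ∈ D) → X ∈ D

/-- `δ` is a cardinal from the point of view of the class `D`. -/
def IsCardIn (D : Set ZFSet) (δ : ZFSet) : Prop :=
  IsOrd δ ∧ δ ∈ D ∧ ∀ γ ∈ δ, ¬ ∃ f ∈ D, IsZFunc γ f ∧ SurjOnto f γ δ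

/-- `δ` is a regular (infinite) cardinal from the point of view of the class `D`. -/
def IsRegularIn (D : Set ZFSet) (δ : ZFSet) : Prop :=
  IsCardIn D δ ∧ ZFSet.omega ⊆ δ ∧
  ∀ γ ∈ δ, ∀ f ∈ D, IsZFunc γ f → MapsInto f γ δ →
    ∃ β ∈ δ, ∀ a ∈ γ, fapp f a ∈ β

/-- `H_λ` as computed in the model `V`: the members of `V` having, in `V`,
a transitive superset of size `< λ`. -/
def HIn (V lam : ZFSet) : Set ZFSet :=
  { x | x ∈ V ∧ ∃ t ∈ V.toSet, x ⊆ t ∧ t.IsTransitive ∧ SizeLTin V.toSet t lam }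

/-- `V` and `V'` have the same ordinals. -/
def SameOrdinals (D D' : Set ZFSet) : Prop :=
  ∀ α, IsOrd α → (α ∈ D ↔ α ∈ D')

/-- Every `ω`-sequence of elements of `ℳ` lying in `ℳ'` is an element of `ℳ`. -/
def OmegaSeqClosedPair (ℳ ℳ' : ZFSet) : Prop :=
  ∀ f ∈ ℳ'.toSet, IsZFunc ZFSet.omega f → (∀ n ∈ ZFSet.omega, fapp f n ∈ ℳ) → f ∈ ℳ

/-! ### Large cardinal properties -/

/-- `κ` is Ramsey: every `A ⊆ κ` belongs to a weak `κ`-model `M` carrying a weakly amenable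
`ω₁`-intersecting `M`-ultrafilter on `κ`. -/
def IsRamseyCard (κ : ZFSet) : Prop :=
  IsCard κ ∧ ∀ A : ZFSet, A ⊆ κ →
    ∃ M, IsWeakModel κ M ∧ A ∈ M ∧
      ∃ U, IsMUltrafilter κ M U ∧ WeaklyAmenable κ M U ∧ OmegaOneIntersecting U

/-- `κ` is strongly Ramsey: the model `M` can moreover be taken to be a `κ`-model. -/
def IsStronglyRamseyCard (κ : ZFSet) : Prop :=
  IsCard κ ∧ ∀ A : ZFSet, A ⊆ κ →
    ∃ M, IsKappaModel κ M ∧ A ∈ M ∧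
      ∃ U, IsMUltrafilter κ M U ∧ WeaklyAmenable κ M U ∧ OmegaOneIntersecting U

/-- `κ` is super Ramsey: the model `M` can moreover be taken to be a `κ`-model
elementary in `H_{κ⁺}`. -/
def IsSuperRamseyCard (κ : ZFSet) : Prop :=
  IsCard κ ∧ ∀ A : ZFSet, A ⊆ κ →
    ∃ M, IsKappaModel κ M ∧ ElemSub M.toSet (Hclass κ) ∧ A ∈ M ∧
      ∃ U, IsMUltrafilter κ M U ∧ WeaklyAmenable κ M U ∧ OmegaOneIntersecting U

/-- `κ` is weakly super Ramsey: the model `M` is a weak `κ`-model elementary in `H_{κ⁺}`. -/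
def IsWeaklySuperRamseyCard (κ : ZFSet) : Prop :=
  IsCard κ ∧ ∀ A : ZFSet, A ⊆ κ →
    ∃ M, IsWeakModel κ M ∧ ElemSub M.toSet (Hclass κ) ∧ A ∈ M ∧
      ∃ U, IsMUltrafilter κ M U ∧ WeaklyAmenable κ M U ∧ OmegaOneIntersecting U

/-- `κ` is measurable: there is a `κ`-complete nonprincipal ultrafilter on (all) subsets
of `κ`. -/
def IsMeasurableCard (κ : ZFSet) : Prop :=
  IsCard κ ∧ ZFSet.omega ∈ κ ∧
  ∃ 𝒰 : Set ZFSet,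
    (∀ A ∈ 𝒰, A ⊆ κ) ∧ (∅ : ZFSet) ∉ 𝒰 ∧ κ ∈ 𝒰 ∧
    (∀ A ∈ 𝒰, ∀ B : ZFSet, B ⊆ κ → A ⊆ B → B ∈ 𝒰) ∧
    (∀ A : ZFSet, A ⊆ κ → (A ∈ 𝒰 ∨ compl κ A ∈ 𝒰)) ∧
    (∀ γ ∈ κ.toSet, ∀ s : ZFSet → ZFSet, (∀ i ∈ γ, s i ∈ 𝒰) →
      ZFSet.sep (fun ξ => ∀ i ∈ γ, ξ ∈ s i) κ ∈ 𝒰)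

/-! ### Relativized large-cardinal properties -/

/-- `N ⊨ κ is Ramsey` (for a transitive model `N`): the witnessing models and ultrafilters
lie in `N`, smallness of the models is witnessed in `N`, and `ω₁`-intersectingness is
evaluated using the sequences in `N`. -/
def RamseyCardIn (N κ : ZFSet) : Prop :=
  ∀ A ∈ N.toSet, A ⊆ κ →
    ∃ M ∈ N.toSet, A ∈ M ∧ IsTransModel M ∧ κ ∈ M ∧
      (∃ f ∈ N.toSet, IsZFunc κ f ∧ SurjOnto f κ M) ∧
      ∃ U ∈ N.toSet, IsMUltrafilter κ M U ∧ WeaklyAmenable κ M U ∧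
        OmegaOneIntersectingIn N U

/-- `N ⊨ κ is strongly Ramsey`. -/
def StronglyRamseyCardIn (N κ : ZFSet) : Prop :=
  ∀ A ∈ N.toSet, A ⊆ κ →
    ∃ M ∈ N.toSet, A ∈ M ∧ IsTransModel M ∧ κ ∈ M ∧
      (∃ f ∈ N.toSet, IsZFunc κ f ∧ SurjOnto f κ M) ∧
      (∀ f ∈ N.toSet, ∀ γ ∈ κ, IsZFunc γ f → (∀ a ∈ γ, fapp f a ∈ M) → f ∈ M) ∧
      ∃ U ∈ N.toSet, IsMUltrafilter κ M U ∧ WeaklyAmenable κ M U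

/-- `N ⊨ κ is super Ramsey`. -/
def SuperRamseyCardIn (N κ : ZFSet) : Prop :=
  ∀ A ∈ N.toSet, A ⊆ κ →
    ∃ M ∈ N.toSet, A ∈ M ∧ IsTransModel M ∧ κ ∈ M ∧
      (∃ f ∈ N.toSet, IsZFunc κ f ∧ SurjOnto f κ M) ∧
      (∀ f ∈ N.toSet, ∀ γ ∈ κ, IsZFunc γ f → (∀ a ∈ γ, fapp f a ∈ M) → f ∈ M) ∧
      ElemSub M.toSet (HclassIn N κ) ∧
      ∃ U ∈ N.toSet, IsMUltrafilter κ M U ∧ WeaklyAmenable κ M U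

/-! ### ω-special models -/

/-- A weak `κ`-model `M` is `ω`-special: it is the union of a chain
`M₀ ≺ M₁ ≺ ⋯` of elementary substructures of `M` with each `Mₙ ∈ M` and `|Mₙ|^M = κ`. -/
def OmegaSpecial (κ M : ZFSet) : Prop :=
  ∃ s : ℕ → ZFSet,
    (∀ n, s n ∈ M) ∧
    (∀ n, (s n).toSet ⊆ (s (n + 1)).toSet) ∧
    (∀ n, ElemSub (s n).toSet M.toSet) ∧
    (∀ n, ∃ f ∈ M.toSet, IsBij f κ (s n)) ∧
    (∀ x, x ∈ M ↔ ∃ n, x ∈ s n)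

/-! ### Iterated ultrapowers and α-iterability -/

/-- `U` is an `α`-iterable `M`-ultrafilter on `κ`: there is a coherent system of transitive
models `Mod β` (`β ≤ α`), with commuting elementary embeddings `e β γ : Mod β → Mod γ`,
critical sequence `cr β` and ultrafilter sequence `Us β`, starting at `(M, κ, U)`, where each
successor step is given by an ultrapower and each limit step is a (collapsed) direct limit. -/
def IsAlphaIterable (κ M U : ZFSet) (α : Ordinal) : Prop :=
  ∃ (Mod : Ordinal → ZFSet) (cr : Ordinal → ZFSet) (Us : Ordinal → ZFSet)
    (e : Ordinal → Ordinal → ZFSet → ZFSet),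
    Mod 0 = M ∧ cr 0 = κ ∧ Us 0 = U ∧
    (∀ β ≤ α, (Mod β).IsTransitive) ∧
    (∀ β ≤ α, ∀ x ∈ Mod β, e β β x = x) ∧
    (∀ β γ ρ : Ordinal, β ≤ γ → γ ≤ ρ → ρ ≤ α →
      ∀ x ∈ Mod β, e γ ρ (e β γ x) = e β ρ x) ∧
    (∀ β γ : Ordinal, β ≤ γ → γ ≤ α →
      (∀ x ∈ Mod β, e β γ x ∈ Mod γ) ∧
      ∀ (φ : Fml) (v : ℕ → ZFSet), (∀ n, v n ∈ Mod β) →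
        (Sat (Mod β).toSet φ v ↔ Sat (Mod γ).toSet φ (fun n => e β γ (v n)))) ∧
    (∀ β : Ordinal, β + 1 ≤ α →
      IsUltrapowerEmb (cr β) (Mod β) (Us β) (Mod (β + 1)) (e β (β + 1)) ∧
      cr (β + 1) = e β (β + 1) (cr β) ∧
      (∀ A, A ∈ Us (β + 1) ↔
        ∃ X ∈ (Mod β).toSet, X ∩ Us β ∈ Mod β ∧ A ∈ e β (β + 1) (X ∩ Us β))) ∧
    (∀ lam : Ordinal, lam ≤ α → lam ≠ 0 → (∀ β < lam, β + 1 < lam) →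
      (∀ x ∈ Mod lam, ∃ β < lam, ∃ y ∈ (Mod β).toSet, e β lam y = x) ∧
      cr lam = e 0 lam κ ∧
      (∀ A, A ∈ Us lam ↔ ∃ β < lam, ∃ B, B ∈ Us β ∧ e β lam B = A))

/-- `N ⊨ κ is α-iterable`: every `A ⊆ κ` in `N` belongs to a weak `κ`-model `M ∈ N` for
which there is a weakly amenable `α`-iterable `M`-ultrafilter `U ∈ N` on `κ`. -/
def AlphaIterableCardIn (N κ : ZFSet) (α : Ordinal) : Prop :=
  ∀ A ∈ N.toSet, A ⊆ κ →
    ∃ M ∈ N.toSet, A ∈ M ∧ IsTransModel M ∧ κ ∈ M ∧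
      (∃ f ∈ N.toSet, IsZFunc κ f ∧ SurjOnto f κ M) ∧
      ∃ U ∈ N.toSet, IsMUltrafilter κ M U ∧ WeaklyAmenable κ M U ∧
        IsAlphaIterable κ M U α

/-! ### Forcing -/

/-- `R` codes a partial order (of forcing conditions) on `P`: `pair p q ∈ R` means `p ≤ q`. -/
def IsPoset (P R : ZFSet) : Prop :=
  (∀ p ∈ R, ∃ a ∈ P, ∃ b ∈ P, p = ZFSet.pair a b) ∧
  (∀ p ∈ P, ZFSet.pair p p ∈ R) ∧
  (∀ p ∈ P, ∀ q ∈ P, ∀ r ∈ P,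
    ZFSet.pair p q ∈ R → ZFSet.pair q r ∈ R → ZFSet.pair p r ∈ R)

/-- `G` is an `ℳ`-generic filter on the poset `(P, R)`. -/
def IsGenericFilter (ℳ P R : ZFSet) (G : Set ZFSet) : Prop :=
  G ⊆ P.toSet ∧ G.Nonempty ∧
  (∀ p ∈ G, ∀ q ∈ G, ∃ r ∈ G, ZFSet.pair r p ∈ R ∧ ZFSet.pair r q ∈ R) ∧
  (∀ p ∈ G, ∀ q ∈ P.toSet, ZFSet.pair p q ∈ R → q ∈ G) ∧
  ∀ Dset ∈ ℳ.toSet, Dset ⊆ P →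
    (∀ p ∈ P.toSet, ∃ q ∈ Dset.toSet, ZFSet.pair q p ∈ R) →
    ∃ q ∈ G, q ∈ Dset

/-- `ℳ'` is the generic extension `ℳ[G]`: the least transitive ZFC⁻-model containing `ℳ`
and (a set coding) `G`, with the same ordinals as `ℳ`. -/
def IsGenericExt (ℳ ℳ' : ZFSet) (G : Set ZFSet) : Prop :=
  IsTransModel ℳ' ∧ ℳ ⊆ ℳ' ∧ (∃ g ∈ ℳ'.toSet, g.toSet = G) ∧
  SameOrdinals ℳ.toSet ℳ'.toSet ∧
  ∀ N', IsTransModel N' → ℳ ⊆ N' → (∃ g ∈ N'.toSet, g.toSet = G) → ℳ' ⊆ N'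

/-- `f ∈ D` is a cofinal map from `γ` into the ordinal `α`. -/
def CofinalMapIn (D : Set ZFSet) (γ α f : ZFSet) : Prop :=
  f ∈ D ∧ IsZFunc γ f ∧ MapsInto f γ α ∧
  ∀ b ∈ α, ∃ a ∈ γ, b ∈ fapp f a ∨ b = fapp f a

/-- `γ` is the cofinality of the ordinal `α` as computed in `D`. -/
def IsCofIn (D : Set ZFSet) (α γ : ZFSet) : Prop :=
  IsOrd γ ∧ (∃ f, CofinalMapIn D γ α f) ∧ ∀ γ' ∈ γ, ¬ ∃ f, CofinalMapIn D γ' α f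

/-- The pair `ℳ ⊆ ℳ'` preserves all cofinalities. -/
def PreservesCofinalities (ℳ ℳ' : ZFSet) : Prop :=
  ∀ α ∈ ℳ.toSet, IsOrd α → ∀ γ, (IsCofIn ℳ.toSet α γ ↔ IsCofIn ℳ'.toSet α γ)

/-- The order on Ramsey measures on `κ`: `U ◁ W` iff `U ∈ N_W`. -/
def ramseyMeasureOrder (κ : ZFSet) (U W : ZFSet) : Prop :=
  IsRamseyMeasure κ U ∧ IsRamseyMeasure κ W ∧ U ∈ NU κ W

universe u

/-! ## Definability framework -/

/-- Contexts: finite nested products of sets. -/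
class Ctx (E : Type (u + 1)) where
  len : ℕ
  get : (ℕ → ZFSet.{u}) → E
  loc : ∀ v w : ℕ → ZFSet.{u}, (∀ i < len, v i = w i) → get v = get w

instance instCtxUnit : Ctx.{u} PUnit.{u + 2} where
  len := 0
  get := fun _ => PUnit.unit
  loc := fun _ _ _ => rfl

instance instCtxProd (E : Type (u + 1)) [Ctx.{u} E] : Ctx.{u} (E × ZFSet.{u}) where
  len := Ctx.len.{u} E + 1
  get := fun v => (Ctx.get v, v (Ctx.len.{u} E))
  loc := fun v w h => by
    rw [Ctx.loc v w (fun i hi => h i (by omega)), h _ (by omega)]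

/-- Uniform definability over all transitive sets. -/
class Df {E : Type (u + 1)} [Ctx.{u} E] (P : ZFSet.{u} → E → Prop) : Prop where
  ex : ∃ φ : Fml, ∀ M : ZFSet.{u}, M.IsTransitive → ∀ v : ℕ → ZFSet.{u}, (∀ n, v n ∈ M) →
    (Sat M.toSet φ v ↔ P M (Ctx.get v))

/-- Context variables. -/
class Var {E : Type (u + 1)} [Ctx.{u} E] (t : E → ZFSet.{u}) : Prop where
  ex : ∃ i : ℕ, i < Ctx.len.{u} E ∧ ∀ v : ℕ → ZFSet.{u}, t (Ctx.get v) = v i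

section rules

variable {E : Type (u + 1)} [Ctx.{u} E]

theorem Var.prev {t : E → ZFSet.{u}} (h : Var t) : Var (fun e : E × ZFSet.{u} => t e.1) := by
  obtain ⟨i, hi, h⟩ := h.ex
  exact ⟨i, Nat.lt_succ_of_lt hi, fun v => h v⟩

instance var0 : Var (fun e : E × ZFSet.{u} => e.2) :=
  ⟨Ctx.len.{u} E, Nat.lt_succ_self _, fun _ => rfl⟩
instance var1 : Var (fun e : (E × ZFSet.{u}) × ZFSet.{u} => e.1.2) := var0.prev
instance var2 : Var (fun e : ((E × ZFSet.{u}) × ZFSet.{u}) × ZFSet.{u} => e.1.1.2) := var1.prev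
instance var3 : Var (fun e : (((E × ZFSet.{u}) × ZFSet.{u}) × ZFSet.{u}) × ZFSet.{u} =>
  e.1.1.1.2) := var2.prev
instance var4 : Var (fun e : ((((E × ZFSet.{u}) × ZFSet.{u}) × ZFSet.{u}) × ZFSet.{u}) ×
  ZFSet.{u} => e.1.1.1.1.2) := var3.prev
instance var5 : Var (fun e : (((((E × ZFSet.{u}) × ZFSet.{u}) × ZFSet.{u}) × ZFSet.{u}) ×
  ZFSet.{u}) × ZFSet.{u} => e.1.1.1.1.1.2) := var4.prev
instance var6 : Var (fun e : ((((((E × ZFSet.{u}) × ZFSet.{u}) × ZFSet.{u}) × ZFSet.{u}) ×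
  ZFSet.{u}) × ZFSet.{u}) × ZFSet.{u} => e.1.1.1.1.1.1.2) := var5.prev
instance var7 : Var (fun e : (((((((E × ZFSet.{u}) × ZFSet.{u}) × ZFSet.{u}) × ZFSet.{u}) ×
  ZFSet.{u}) × ZFSet.{u}) × ZFSet.{u}) × ZFSet.{u} => e.1.1.1.1.1.1.1.2) := var6.prev
instance var8 : Var (fun e : ((((((((E × ZFSet.{u}) × ZFSet.{u}) × ZFSet.{u}) × ZFSet.{u}) ×
  ZFSet.{u}) × ZFSet.{u}) × ZFSet.{u}) × ZFSet.{u}) × ZFSet.{u} =>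
  e.1.1.1.1.1.1.1.1.2) := var7.prev
instance var9 : Var (fun e : (((((((((E × ZFSet.{u}) × ZFSet.{u}) × ZFSet.{u}) × ZFSet.{u}) ×
  ZFSet.{u}) × ZFSet.{u}) × ZFSet.{u}) × ZFSet.{u}) × ZFSet.{u}) × ZFSet.{u} =>
  e.1.1.1.1.1.1.1.1.1.2) := var8.prev
instance var10 : Var (fun e : ((((((((((E × ZFSet.{u}) × ZFSet.{u}) × ZFSet.{u}) × ZFSet.{u}) ×
  ZFSet.{u}) × ZFSet.{u}) × ZFSet.{u}) × ZFSet.{u}) × ZFSet.{u}) × ZFSet.{u}) × ZFSet.{u} =>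
  e.1.1.1.1.1.1.1.1.1.1.2) := var9.prev
instance var11 : Var (fun e : (((((((((((E × ZFSet.{u}) × ZFSet.{u}) × ZFSet.{u}) × ZFSet.{u}) ×
  ZFSet.{u}) × ZFSet.{u}) × ZFSet.{u}) × ZFSet.{u}) × ZFSet.{u}) × ZFSet.{u}) × ZFSet.{u}) ×
  ZFSet.{u} => e.1.1.1.1.1.1.1.1.1.1.1.2) := var10.prev
instance var12 : Var (fun e : ((((((((((((E × ZFSet.{u}) × ZFSet.{u}) × ZFSet.{u}) × ZFSet.{u}) ×
  ZFSet.{u}) × ZFSet.{u}) × ZFSet.{u}) × ZFSet.{u}) × ZFSet.{u}) × ZFSet.{u}) × ZFSet.{u}) ×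
  ZFSet.{u}) × ZFSet.{u} => e.1.1.1.1.1.1.1.1.1.1.1.1.2) := var11.prev

instance df_mem (s t : E → ZFSet.{u}) [hs : Var s] [ht : Var t] :
    Df (fun _ e => s e ∈ t e) := by
  obtain ⟨i, -, hi⟩ := hs.ex
  obtain ⟨k, -, hk⟩ := ht.ex
  exact ⟨.mem i k, fun M _ v _ => by simp [Sat, hi, hk]⟩

instance df_eq (s t : E → ZFSet.{u}) [hs : Var s] [ht : Var t] :
    Df (fun _ e => s e = t e) := by
  obtain ⟨i, -, hi⟩ := hs.ex
  obtain ⟨k, -, hk⟩ := ht.ex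
  exact ⟨.eq i k, fun M _ v _ => by simp [Sat, hi, hk]⟩

instance df_imp (P Q : ZFSet.{u} → E → Prop) [hP : Df P] [hQ : Df Q] :
    Df (fun M e => P M e → Q M e) := by
  obtain ⟨φ, hφ⟩ := hP.ex
  obtain ⟨ψ, hψ⟩ := hQ.ex
  exact ⟨.impl φ ψ, fun M hM v hv => by simp only [Sat, hφ M hM v hv, hψ M hM v hv]⟩

instance df_not (P : ZFSet.{u} → E → Prop) [hP : Df P] :
    Df (fun M e => ¬ P M e) := by
  obtain ⟨φ, hφ⟩ := hP.ex
  exact ⟨.neg φ, fun M hM v hv => by simp only [Sat, hφ M hM v hv]⟩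

theorem Df.congr {P Q : ZFSet.{u} → E → Prop} (hP : Df P)
    (h : ∀ M : ZFSet.{u}, M.IsTransitive → ∀ v : ℕ → ZFSet.{u}, (∀ n, v n ∈ M) →
      (P M (Ctx.get v) ↔ Q M (Ctx.get v))) : Df Q := by
  obtain ⟨φ, hφ⟩ := hP.ex
  exact ⟨φ, fun M hM v hv => (hφ M hM v hv).trans (h M hM v hv)⟩

instance df_and (P Q : ZFSet.{u} → E → Prop) [hP : Df P] [hQ : Df Q] :
    Df (fun M e => P M e ∧ Q M e) :=
  (inferInstance : Df (fun M e => ¬ (P M e → ¬ Q M e))).congr (fun _ _ _ _ => by tauto)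

instance df_or (P Q : ZFSet.{u} → E → Prop) [hP : Df P] [hQ : Df Q] :
    Df (fun M e => P M e ∨ Q M e) :=
  (inferInstance : Df (fun M e => (¬ P M e → Q M e))).congr (fun _ _ _ _ => by tauto)

instance df_iff (P Q : ZFSet.{u} → E → Prop) [hP : Df P] [hQ : Df Q] :
    Df (fun M e => P M e ↔ Q M e) :=
  (inferInstance : Df (fun M e => (P M e → Q M e) ∧ (Q M e → P M e))).congr
    (fun _ _ _ _ => by tauto)

theorem get_update (v : ℕ → ZFSet.{u}) (x : ZFSet.{u}) :
    (Ctx.get (Function.update v (Ctx.len.{u} E) x) : E) = Ctx.get v :=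
  Ctx.loc _ _ (fun i hi => by rw [Function.update_of_ne (by omega)])

instance df_all (B : ZFSet.{u} → E → ZFSet.{u} → Prop)
    [hB : Df (fun M (e : E × ZFSet.{u}) => B M e.1 e.2)] :
    Df (fun M e => ∀ x ∈ M, B M e x) := by
  obtain ⟨φ, hφ⟩ := hB.ex
  refine ⟨.all (Ctx.len.{u} E) φ, fun M hM v hv => ?_⟩
  simp only [Sat]
  refine forall_congr' fun x => forall_congr' fun hx => ?_
  rw [hφ M hM _ (fun n => ?_)]
  · show B M (Ctx.get _) (Function.update v (Ctx.len.{u} E) x (Ctx.len.{u} E)) ↔ _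
    rw [get_update, Function.update_self]
  · by_cases h : n = Ctx.len.{u} E
    · subst h; rw [Function.update_self]; exact hx
    · rw [Function.update_of_ne h]; exact hv n

instance df_ex (B : ZFSet.{u} → E → ZFSet.{u} → Prop)
    [hB : Df (fun M (e : E × ZFSet.{u}) => B M e.1 e.2)] :
    Df (fun M e => ∃ x ∈ M, B M e x) := by
  have : Df (fun M (e : E × ZFSet.{u}) => ¬ B M e.1 e.2) := df_not _
  have : Df (fun M (e : E) => ∀ x ∈ M, ¬ B M e x) := df_all (fun M e x => ¬ B M e x)
  exact (df_not (fun M (e : E) => ∀ x ∈ M, ¬ B M e x)).congr (fun _ _ _ _ => by push Not; rfl)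

theorem Var.mem {t : E → ZFSet.{u}} (h : Var t) {M : ZFSet.{u}} {v : ℕ → ZFSet.{u}}
    (hv : ∀ n, v n ∈ M) : t (Ctx.get v) ∈ M := by
  obtain ⟨i, -, hi⟩ := h.ex
  rw [hi]; exact hv i

instance df_ball (t : E → ZFSet.{u}) (B : ZFSet.{u} → E → ZFSet.{u} → Prop) [ht : Var t]
    [hB : Df (fun M (e : E × ZFSet.{u}) => B M e.1 e.2)] :
    Df (fun M e => ∀ x ∈ t e, B M e x) := by
  have := ht.prev
  have h1 : Df (fun M (e : E × ZFSet.{u}) => e.2 ∈ t e.1 → B M e.1 e.2) :=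
    df_imp (fun M (e : E × ZFSet.{u}) => e.2 ∈ t e.1) _
  have : Df (fun M (e : E) => ∀ x ∈ M, x ∈ t e → B M e x) :=
    df_all (fun M e x => x ∈ t e → B M e x)
  exact this.congr (fun M hM v hv =>
    ⟨fun h x hx => h x (hM _ (ht.mem hv) hx) hx, fun h x _ hx => h x hx⟩)

instance df_bex (t : E → ZFSet.{u}) (B : ZFSet.{u} → E → ZFSet.{u} → Prop) [ht : Var t]
    [hB : Df (fun M (e : E × ZFSet.{u}) => B M e.1 e.2)] :
    Df (fun M e => ∃ x ∈ t e, B M e x) := by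
  have : Df (fun M (e : E × ZFSet.{u}) => ¬ B M e.1 e.2) := df_not _
  have : Df (fun M (e : E) => ∀ x ∈ t e, ¬ B M e x) := df_ball t (fun M e x => ¬ B M e x)
  exact (df_not (fun M (e : E) => ∀ x ∈ t e, ¬ B M e x)).congr (fun _ _ _ _ => by push Not; rfl)

instance df_sub (s t : E → ZFSet.{u}) [hs : Var s] [ht : Var t] :
    Df (fun _ e => s e ⊆ t e) := by
  have := ht.prev
  have : Df (fun M (e : E) => ∀ x ∈ s e, x ∈ t e) := df_ball s (fun M e x => x ∈ t e)
  exact this.congr (fun _ _ _ _ => Iff.rfl)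

theorem eq_pair_iff (x y z : ZFSet.{u}) : z = pair x y ↔
    ∃ a ∈ z, ∃ b ∈ z, (∀ c ∈ z, c = a ∨ c = b) ∧ (x ∈ a ∧ ∀ c ∈ a, c = x) ∧
      (x ∈ b ∧ y ∈ b ∧ ∀ c ∈ b, c = x ∨ c = y) := by
  constructor
  · rintro rfl
    refine ⟨{x}, by simp [pair], {x, y}, by simp [pair], ?_⟩
    simp [pair]
  · rintro ⟨a, ha, b, hb, h1, ⟨h2, h3⟩, h4, h5, h6⟩
    have ea : a = {x} := by
      ext c; rw [mem_singleton]
      exact ⟨h3 c, fun h => h ▸ h2⟩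
    have eb : b = {x, y} := by
      ext c; rw [mem_pair]
      refine ⟨h6 c, fun h => ?_⟩
      rcases h with rfl | rfl <;> assumption
    ext c
    rw [pair, ← ea, ← eb, mem_pair]
    refine ⟨h1 c, fun h => ?_⟩
    rcases h with rfl | rfl <;> assumption

instance df_eqPair (s t r : E → ZFSet.{u}) [hs : Var s] [ht : Var t] [hr : Var r] :
    Df (fun _ e => s e = pair (t e) (r e)) := by
  have h1 := hs.prev
  have h2 := ht.prev
  have h3 := hr.prev
  have h4 := h1.prev
  have h5 := h2.prev
  have h6 := h3.prev
  have h7 := h5.prev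
  have h8 := h6.prev
  have : Df (fun M (e : E) => ∃ a ∈ s e, ∃ b ∈ s e, (∀ c ∈ s e, c = a ∨ c = b) ∧
      (t e ∈ a ∧ ∀ c ∈ a, c = t e) ∧
      (t e ∈ b ∧ r e ∈ b ∧ ∀ c ∈ b, c = t e ∨ c = r e)) := inferInstance
  exact this.congr (fun _ _ v _ => (eq_pair_iff _ _ _).symm)

instance df_pairMem (s t r : E → ZFSet.{u}) [hs : Var s] [ht : Var t] [hr : Var r] :
    Df (fun _ e => pair (s e) (t e) ∈ r e) := by
  have h1 := hs.prev
  have h2 := ht.prev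
  have : Df (fun M (e : E) => ∃ a ∈ r e, a = pair (s e) (t e)) := inferInstance
  exact this.congr (fun _ _ v _ => by simp)

end rules


/-! ## Good models -/

/-- Contexts with five parameters. -/
abbrev C5 : Type (u + 1) :=
  ((((PUnit.{u + 2} × ZFSet.{u}) × ZFSet.{u}) × ZFSet.{u}) × ZFSet.{u}) × ZFSet.{u}

/-- Definable predicates with five arguments. -/
abbrev Df5 (P : ZFSet.{u} → ZFSet.{u} → ZFSet.{u} → ZFSet.{u} → ZFSet.{u} → ZFSet.{u} → Prop) :
    Prop :=
  Df (fun M (q : C5.{u}) => P M q.1.1.1.1.2 q.1.1.1.2 q.1.1.2 q.1.2 q.2)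

/-- Definable predicates with six arguments. -/
abbrev Df6 (P : ZFSet.{u} → ZFSet.{u} → ZFSet.{u} → ZFSet.{u} → ZFSet.{u} → ZFSet.{u} →
    ZFSet.{u} → Prop) : Prop :=
  Df (fun M (q : C5.{u} × ZFSet.{u}) =>
    P M q.2 q.1.1.1.1.1.2 q.1.1.1.1.2 q.1.1.1.2 q.1.1.2 q.1.2)

/-- Definable predicates with seven arguments. -/
abbrev Df7 (P : ZFSet.{u} → ZFSet.{u} → ZFSet.{u} → ZFSet.{u} → ZFSet.{u} → ZFSet.{u} →
    ZFSet.{u} → ZFSet.{u} → Prop) : Prop :=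
  Df (fun M (q : (C5.{u} × ZFSet.{u}) × ZFSet.{u}) =>
    P M q.1.2 q.2 q.1.1.1.1.1.1.2 q.1.1.1.1.1.2 q.1.1.1.1.2 q.1.1.1.2 q.1.1.2)

/-- The list of five parameters as a valuation. -/
def val5 (a b c d e z : ZFSet.{u}) : ℕ → ZFSet.{u}
  | 0 => a
  | 1 => b
  | 2 => c
  | 3 => d
  | 4 => e
  | _ => z

theorem Df5.sat {P : ZFSet.{u} → ZFSet.{u} → ZFSet.{u} → ZFSet.{u} → ZFSet.{u} → ZFSet.{u} → Prop}
    (h : Df5 P) : ∃ φ : Fml, ∀ M : ZFSet.{u}, M.IsTransitive → ∀ v : ℕ → ZFSet.{u},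
      (∀ n, v n ∈ M) → (Sat M.toSet φ v ↔ P M (v 0) (v 1) (v 2) (v 3) (v 4)) := h.ex

/-- Elementary maps between transitive sets. -/
structure Elem (M N : ZFSet.{u}) (j : ZFSet.{u} → ZFSet.{u}) : Prop where
  trM : M.IsTransitive
  trN : N.IsTransitive
  maps : ∀ x ∈ M, j x ∈ N
  sat : ∀ (φ : Fml) (v : ℕ → ZFSet.{u}), (∀ n, v n ∈ M) →
    (Sat M.toSet φ v ↔ Sat N.toSet φ (fun n => j (v n)))

theorem Elem.elem {M N : ZFSet.{u}} {j : ZFSet.{u} → ZFSet.{u}} (hj : Elem M N j)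
    (P : ZFSet.{u} → ZFSet.{u} → ZFSet.{u} → ZFSet.{u} → ZFSet.{u} → ZFSet.{u} → Prop)
    [h : Df5 P] {a b c d e : ZFSet.{u}} (ha : a ∈ M) (hb : b ∈ M) (hc : c ∈ M) (hd : d ∈ M)
    (he : e ∈ M) : P M a b c d e ↔ P N (j a) (j b) (j c) (j d) (j e) := by
  obtain ⟨φ, hφ⟩ := h.sat
  have hv : ∀ n, val5 a b c d e a n ∈ M := by
    intro n
    rcases n with _ | _ | _ | _ | _ | n <;> assumption
  have h1 := hφ M hj.trM _ hv
  have h2 := hφ N hj.trN (fun n => j (val5 a b c d e a n)) (fun n => hj.maps _ (hv n))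
  exact h1.symm.trans ((hj.sat φ _ hv).trans h2)

/-- Models with pairing, union, separation and collection. -/
structure Good (M : ZFSet.{u}) : Prop where
  tr : M.IsTransitive
  pr : ∀ x ∈ M, ∀ y ∈ M, ({x, y} : ZFSet.{u}) ∈ M
  un : ∀ x ∈ M, (⋃₀ x : ZFSet.{u}) ∈ M
  sep' : ∀ (P : ZFSet.{u} → ZFSet.{u} → ZFSet.{u} → ZFSet.{u} → ZFSet.{u} → ZFSet.{u} →
    ZFSet.{u} → Prop), Df6 P → ∀ s ∈ M, ∀ a ∈ M, ∀ b ∈ M, ∀ c ∈ M, ∀ d ∈ M, ∀ e ∈ M,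
    ∃ t ∈ M, ∀ x ∈ M, x ∈ t ↔ x ∈ s ∧ P M x a b c d e
  coll' : ∀ (P : ZFSet.{u} → ZFSet.{u} → ZFSet.{u} → ZFSet.{u} → ZFSet.{u} → ZFSet.{u} →
    ZFSet.{u} → ZFSet.{u} → Prop), Df7 P → ∀ s ∈ M, ∀ a ∈ M, ∀ b ∈ M, ∀ c ∈ M, ∀ d ∈ M, ∀ e ∈ M,
    (∀ x ∈ s, ∃ y ∈ M, P M x y a b c d e) → ∃ t ∈ M, ∀ x ∈ s, ∃ y ∈ t, P M x y a b c d e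

/-- A fresh renaming is not needed: formulas may be put into any context. -/
def ren (f : ℕ → ℕ) : Fml → Fml
  | .mem i k => .mem (f i) (f k)
  | .eq i k => .eq (f i) (f k)
  | .impl φ ψ => .impl (ren f φ) (ren f ψ)
  | .neg φ => .neg (ren f φ)
  | .all n φ => .all (f n) (ren f φ)

theorem sat_ren (D : Set ZFSet.{u}) (f : ℕ → ℕ) (hf : Function.Injective f) (φ : Fml) :
    ∀ v : ℕ → ZFSet.{u}, Sat D (ren f φ) v ↔ Sat D φ (fun n => v (f n)) := by
  induction φ with
  | mem i k => intro v; rfl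
  | eq i k => intro v; rfl
  | impl φ ψ h1 h2 => intro v; simp only [ren, Sat, h1, h2]
  | neg φ h => intro v; simp only [ren, Sat, h]
  | all n φ h =>
    intro v; simp only [ren, Sat, h]
    refine forall_congr' fun x => forall_congr' fun _ => ?_
    have : (fun m => Function.update v (f n) x (f m)) = Function.update (fun m => v (f m)) n x := by
      funext m
      by_cases hm : m = n
      · subst hm; simp
      · rw [Function.update_of_ne hm, Function.update_of_ne (fun h => hm (hf h))]
    rw [this]

theorem upd_mem {M : ZFSet.{u}} {v : ℕ → ZFSet.{u}} (hv : ∀ n, v n ∈ M) (k : ℕ) {x : ZFSet.{u}}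
    (hx : x ∈ M) (n : ℕ) : Function.update v k x n ∈ M := by
  by_cases h : n = k
  · subst h; rw [Function.update_self]; exact hx
  · rw [Function.update_of_ne h]; exact hv n

theorem good_of_model {M : ZFSet.{u}} (h : IsTransModel M) : Good M := by
  obtain ⟨tr, -, pr, un, sp, cl, -⟩ := h
  refine ⟨tr, pr, un, ?_, ?_⟩
  · intro P hP s hs a ha b hb c hc d hd e he
    obtain ⟨φ, hφ⟩ := hP.ex
    let g : Equiv.Perm ℕ := Equiv.swap 0 5
    have hv : ∀ n, val5 a b c d e a n ∈ M := by
      intro n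
      rcases n with _ | _ | _ | _ | _ | n <;> assumption
    obtain ⟨t, ht, h⟩ := sp (ren g φ) (fun n => val5 a b c d e a (g n)) (fun n => hv _) s hs
    refine ⟨t, ht, fun x hx => ?_⟩
    rw [h, sat_ren _ _ g.injective, hφ M tr _ (fun n => upd_mem (fun _ => hv _) _ hx _)]
    exact Iff.rfl
  · intro P hP s hs a ha b hb c hc d hd e he hyp
    obtain ⟨φ, hφ⟩ := hP.ex
    let f : ℕ → ℕ := fun n => match n with
      | 0 => 2 | 1 => 3 | 2 => 4 | 3 => 5 | 4 => 6 | 5 => 0 | 6 => 1 | n + 7 => n + 7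
    have hf : Function.Injective f := by
      intro m n hmn
      rcases m with _ | _ | _ | _ | _ | _ | _ | m <;> rcases n with _ | _ | _ | _ | _ | _ | _ | n <;>
        simp [f] at hmn ⊢ <;> omega
    have hv : ∀ n, (fun n => val5 a b c d e a (n - 2)) n ∈ M := by
      intro n; dsimp only
      rcases (n - 2) with _ | _ | _ | _ | _ | n <;> assumption
    have key : ∀ x ∈ M, ∀ y ∈ M, (Sat M.toSet (ren f φ) (Function.update (Function.update
        (fun n => val5 a b c d e a (n - 2)) 0 x) 1 y) ↔ P M x y a b c d e) := by
      intro x hx y hy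
      rw [sat_ren _ _ hf, hφ M tr _ (fun n => upd_mem (upd_mem hv _ hx) _ hy _)]
      exact Iff.rfl
    obtain ⟨t, ht, h⟩ := cl (ren f φ) _ hv s hs (fun x hx => by
      obtain ⟨y, hy, h⟩ := hyp x hx
      exact ⟨y, hy, (key x (tr _ hs hx) y hy).2 h⟩)
    refine ⟨t, ht, fun x hx => ?_⟩
    obtain ⟨y, hy, h⟩ := h x hx
    exact ⟨y, hy, (key x (tr _ hs hx) y (tr _ ht hy)).1 h⟩

theorem Df.subst {E E' : Type (u + 1)} [Ctx.{u} E] [Ctx.{u} E'] {P : ZFSet.{u} → E → Prop}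
    (h : Df P) (g : E' → E) (f : ℕ → ℕ) (hf : Function.Injective f)
    (hg : ∀ v : ℕ → ZFSet.{u}, Ctx.get (fun n => v (f n)) = g (Ctx.get v)) :
    Df (fun M e => P M (g e)) := by
  obtain ⟨φ, hφ⟩ := h.ex
  refine ⟨ren f φ, fun M hM v hv => ?_⟩
  rw [sat_ren _ _ hf, hφ M hM _ (fun n => hv _), hg]

theorem Elem.closed {M N : ZFSet.{u}} {j : ZFSet.{u} → ZFSet.{u}} (hj : Elem M N j)
    (P : ZFSet.{u} → Prop) (h : Df (fun M (_ : PUnit.{u + 2}) => P M)) {a : ZFSet.{u}}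
    (ha : a ∈ M) : P M ↔ P N := by
  obtain ⟨φ, hφ⟩ := h.ex
  have h1 := hφ M hj.trM (fun _ => a) (fun _ => ha)
  have h2 := hφ N hj.trN (fun _ => j a) (fun _ => hj.maps _ ha)
  exact h1.symm.trans ((hj.sat φ _ (fun _ => ha)).trans h2)

theorem good_of_elem {M N : ZFSet.{u}} {j : ZFSet.{u} → ZFSet.{u}} (hj : Elem M N j)
    (hM : Good M) {a : ZFSet.{u}} (ha : a ∈ M) : Good N := by
  refine ⟨hj.trN, ?_, ?_, ?_, ?_⟩
  · have h1 : Df (fun M (_ : PUnit.{u + 2}) => ∀ x ∈ M, ∀ y ∈ M, ∃ z ∈ M, x ∈ z ∧ y ∈ z ∧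
        ∀ w ∈ z, w = x ∨ w = y) := inferInstance
    have h2 := (hj.closed _ h1 ha).1 (fun x hx y hy => ⟨{x, y}, hM.pr x hx y hy, by simp⟩)
    intro x hx y hy
    obtain ⟨z, hz, h3, h4, h5⟩ := h2 x hx y hy
    have : ({x, y} : ZFSet.{u}) = z := by
      ext w; rw [mem_pair]
      refine ⟨fun h => ?_, h5 w⟩
      rcases h with rfl | rfl <;> assumption
    rw [this]; exact hz
  · have h1 : Df (fun M (_ : PUnit.{u + 2}) => ∀ x ∈ M, ∃ z ∈ M, (∀ y ∈ x, y ⊆ z) ∧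
        ∀ w ∈ z, ∃ y ∈ x, w ∈ y) := inferInstance
    have h2 := (hj.closed _ h1 ha).1 (fun x hx => ⟨⋃₀ x, hM.un x hx,
      fun y hy w hw => mem_sUnion.2 ⟨y, hy, hw⟩, fun w hw => mem_sUnion.1 hw⟩)
    intro x hx
    obtain ⟨z, hz, h3, h4⟩ := h2 x hx
    have : (⋃₀ x : ZFSet.{u}) = z := by
      ext w; rw [mem_sUnion]
      exact ⟨fun ⟨y, hy, hw⟩ => h3 y hy hw, h4 w⟩
    rw [this]; exact hz
  · intro P hP
    have h0 : Df (fun M (q : ((C5.{u} × ZFSet.{u}) × ZFSet.{u}) × ZFSet.{u}) =>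
        P M q.2 q.1.1.1.1.1.1.1.2 q.1.1.1.1.1.1.2 q.1.1.1.1.1.2 q.1.1.1.1.2 q.1.1.1.2) :=
      hP.subst (fun q : ((C5.{u} × ZFSet.{u}) × ZFSet.{u}) × ZFSet.{u} => (q.1.1.1, q.2))
        (Equiv.swap 5 7) (Equiv.injective _) (fun v => rfl)
    have h1 : Df (fun M (_ : PUnit.{u + 2}) => ∀ a ∈ M, ∀ b ∈ M, ∀ c ∈ M, ∀ d ∈ M, ∀ e ∈ M,
      ∀ s ∈ M, ∃ t ∈ M, ∀ x ∈ M, x ∈ t ↔ x ∈ s ∧ P M x a b c d e) := inferInstance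
    have h2 := (hj.closed _ h1 ha).1 (fun a ha b hb c hc d hd e he s hs =>
      hM.sep' P hP s hs a ha b hb c hc d hd e he)
    exact fun s hs a ha b hb c hc d hd e he => h2 a ha b hb c hc d hd e he s hs
  · intro P hP
    have i1 : Df (fun M (q : ((C5.{u} × ZFSet.{u}) × ZFSet.{u}) × ZFSet.{u}) =>
        P M q.1.2 q.2 q.1.1.1.1.1.1.1.2 q.1.1.1.1.1.1.2 q.1.1.1.1.1.2 q.1.1.1.1.2 q.1.1.1.2) :=
      hP.subst (fun q : ((C5.{u} × ZFSet.{u}) × ZFSet.{u}) × ZFSet.{u} =>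
        ((q.1.1.1, q.1.2), q.2))
        ((Equiv.swap 5 6).trans (Equiv.swap 5 7)) (Equiv.injective _) (fun v => rfl)
    have i2 : Df (fun M (q : (((C5.{u} × ZFSet.{u}) × ZFSet.{u}) × ZFSet.{u}) × ZFSet.{u}) =>
        P M q.1.2 q.2 q.1.1.1.1.1.1.1.1.2 q.1.1.1.1.1.1.1.2 q.1.1.1.1.1.1.2 q.1.1.1.1.1.2
          q.1.1.1.1.2) :=
      hP.subst (fun q : (((C5.{u} × ZFSet.{u}) × ZFSet.{u}) × ZFSet.{u}) × ZFSet.{u} =>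
        ((q.1.1.1.1, q.1.2), q.2))
        ((Equiv.swap 5 7).trans (Equiv.swap 6 8)) (Equiv.injective _) (fun v => rfl)
    have h1 : Df (fun M (_ : PUnit.{u + 2}) => ∀ a ∈ M, ∀ b ∈ M, ∀ c ∈ M, ∀ d ∈ M, ∀ e ∈ M,
      ∀ s ∈ M, (∀ x ∈ s, ∃ y ∈ M, P M x y a b c d e) →
        ∃ t ∈ M, ∀ x ∈ s, ∃ y ∈ t, P M x y a b c d e) := inferInstance
    have h2 := (hj.closed _ h1 ha).1 (fun a ha b hb c hc d hd e he s hs =>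
      hM.coll' P hP s hs a ha b hb c hc d hd e he)
    exact fun s hs a ha b hb c hc d hd e he => h2 a ha b hb c hc d hd e he s hs

section good

variable {M : ZFSet.{u}}

theorem Good.sep (hM : Good M) (P : ZFSet.{u} → ZFSet.{u} → ZFSet.{u} → ZFSet.{u} → ZFSet.{u} →
    ZFSet.{u} → ZFSet.{u} → Prop) [hP : Df6 P] {s a b c d e : ZFSet.{u}} (hs : s ∈ M) (ha : a ∈ M)
    (hb : b ∈ M) (hc : c ∈ M) (hd : d ∈ M) (he : e ∈ M) :
    ZFSet.sep (fun x => P M x a b c d e) s ∈ M := by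
  obtain ⟨t, ht, h⟩ := hM.sep' P hP s hs a ha b hb c hc d hd e he
  have : ZFSet.sep (fun x => P M x a b c d e) s = t := by
    ext x
    rw [mem_sep]
    refine ⟨fun hx => (h x (hM.tr _ hs hx.1)).2 hx, fun hx => (h x (hM.tr _ ht hx)).1 hx⟩
  rw [this]; exact ht

/-- Replacement for an external function which is definable on `s`. -/
theorem Good.repl (hM : Good M) (P : ZFSet.{u} → ZFSet.{u} → ZFSet.{u} → ZFSet.{u} → ZFSet.{u} →
    ZFSet.{u} → ZFSet.{u} → ZFSet.{u} → Prop) [hP : Df7 P] (f : ZFSet.{u} → ZFSet.{u})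
    {s a b c d : ZFSet.{u}} (hs : s ∈ M) (ha : a ∈ M)
    (hb : b ∈ M) (hc : c ∈ M) (hd : d ∈ M)
    (hf : ∀ x ∈ s, f x ∈ M) (hPf : ∀ x ∈ s, ∀ y ∈ M, P M x y a b c d s ↔ y = f x) :
    ∃ t ∈ M, ∀ y, y ∈ t ↔ ∃ x ∈ s, y = f x := by
  obtain ⟨t, ht, h⟩ := hM.coll' P hP s hs a ha b hb c hc d hd s hs
    (fun x hx => ⟨f x, hf x hx, (hPf x hx _ (hf x hx)).2 rfl⟩)
  have h1 : ∀ x ∈ s, f x ∈ t := by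
    intro x hx
    obtain ⟨y, hy, h2⟩ := h x hx
    rwa [← (hPf x hx y (hM.tr _ ht hy)).1 h2]
  have i1 : Df (fun M (q : (C5.{u} × ZFSet.{u}) × ZFSet.{u}) =>
      P M q.2 q.1.2 q.1.1.1.1.1.1.2 q.1.1.1.1.1.2 q.1.1.1.1.2 q.1.1.1.2 q.1.1.2) :=
    hP.subst (fun q : (C5.{u} × ZFSet.{u}) × ZFSet.{u} => ((q.1.1, q.2), q.1.2))
      ((Equiv.swap 5 6)) (Equiv.injective _) (fun v => rfl)
  have i2 : Df (fun M (q : (C5.{u} × ZFSet.{u})) => ∃ x ∈ q.1.2,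
      P M x q.2 q.1.1.1.1.1.2 q.1.1.1.1.2 q.1.1.1.2 q.1.1.2 q.1.2) := inferInstance
  refine ⟨_, @Good.sep M hM (fun M y a b c d s => ∃ x ∈ s, P M x y a b c d s) i2 _ _ _ _ _ _
    ht ha hb hc hd hs, fun y => ?_⟩
  rw [mem_sep]
  constructor
  · rintro ⟨hy, x, hx, h⟩
    exact ⟨x, hx, (hPf x hx y (hM.tr _ ht hy)).1 h⟩
  · rintro ⟨x, hx, rfl⟩
    exact ⟨h1 x hx, x, hx, (hPf x hx _ (hf x hx)).2 rfl⟩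

theorem Good.singleton (hM : Good M) {x : ZFSet.{u}} (hx : x ∈ M) : ({x} : ZFSet.{u}) ∈ M := by
  have := hM.pr x hx x hx
  rwa [pair_eq_singleton] at this

theorem Good.opair (hM : Good M) {x y : ZFSet.{u}} (hx : x ∈ M) (hy : y ∈ M) : pair x y ∈ M :=
  hM.pr _ (hM.singleton hx) _ (hM.pr _ hx _ hy)

theorem Good.empty (hM : Good M) {x : ZFSet.{u}} (hx : x ∈ M) : (∅ : ZFSet.{u}) ∈ M := by
  have := hM.sep (fun _ x _ _ _ _ _ => ¬ x = x) hx hx hx hx hx hx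
  convert this using 1
  ext z; simp

theorem Good.union (hM : Good M) {x y : ZFSet.{u}} (hx : x ∈ M) (hy : y ∈ M) :
    x ∪ y ∈ M := by
  have := hM.un _ (hM.pr _ hx _ hy)
  convert this using 1
  ext z; simp

theorem Tr.pair_left {z x y : ZFSet.{u}} (hz : z.IsTransitive) (h : pair x y ∈ z) : x ∈ z :=
  hz _ (hz _ h (by simp [pair] : ({x} : ZFSet.{u}) ∈ pair x y)) (by simp)

theorem Tr.pair_right {z x y : ZFSet.{u}} (hz : z.IsTransitive) (h : pair x y ∈ z) : y ∈ z :=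
  hz _ (hz _ h (by simp [pair] : ({x, y} : ZFSet.{u}) ∈ pair x y)) (by simp)

theorem Good.prod (hM : Good M) {s t : ZFSet.{u}} (hs : s ∈ M) (ht : t ∈ M) :
    s.prod t ∈ M := by
  have h1 : ∀ x ∈ s, ∃ z ∈ M, ∀ w, w ∈ z ↔ ∃ y ∈ t, w = pair x y := by
    intro x hx
    have hx' := hM.tr _ hs hx
    exact hM.repl (fun _ y w x _ _ _ _ => w = pair x y) (fun y => pair x y) ht hx' hx' hx' hx'
      (fun y hy => hM.opair hx' (hM.tr _ ht hy)) (fun _ _ _ _ => Iff.rfl)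
  choose! f hf using h1
  obtain ⟨P, hP, h2⟩ := hM.repl (fun _ x z t _ _ _ _ => (∀ w ∈ z, ∃ y ∈ t, w = pair x y) ∧
      ∀ y ∈ t, ∃ w ∈ z, w = pair x y) f hs ht ht ht ht (fun x hx => (hf x hx).1) (by
    intro x hx z _
    constructor
    · rintro ⟨h3, h4⟩
      ext w
      rw [(hf x hx).2]
      refine ⟨h3 w, ?_⟩
      rintro ⟨y, hy, rfl⟩
      obtain ⟨w, hw, rfl⟩ := h4 y hy
      exact hw
    · rintro rfl
      exact ⟨fun w hw => ((hf x hx).2 w).1 hw, fun y hy => ⟨_, ((hf x hx).2 _).2 ⟨y, hy, rfl⟩, rfl⟩⟩)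
  have h3 := hM.un _ hP
  convert h3 using 1
  ext w
  rw [mem_prod, mem_sUnion]
  constructor
  · rintro ⟨x, hx, y, hy, rfl⟩
    exact ⟨f x, (h2 _).2 ⟨x, hx, rfl⟩, ((hf x hx).2 _).2 ⟨y, hy, rfl⟩⟩
  · rintro ⟨z, hz, hw⟩
    obtain ⟨x, hx, rfl⟩ := (h2 _).1 hz
    obtain ⟨y, hy, rfl⟩ := ((hf x hx).2 _).1 hw
    exact ⟨x, hx, y, hy, rfl⟩

end good

/-! ## Mostowski collapse -/

/-- `p` is the collapsing map of the relation `r` on `d`. -/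
def Col (d r : ZFSet.{u}) (p : ZFSet.{u} → ZFSet.{u}) : Prop :=
  ∀ x ∈ d, ∀ z, z ∈ p x ↔ ∃ y ∈ d, pair y x ∈ r ∧ z = p y

theorem col_exists {d r : ZFSet.{u}}
    (wf : WellFounded (fun y x : ZFSet.{u} => y ∈ d ∧ pair y x ∈ r)) :
    ∃ p, Col d r p := by
  classical
  let F : ∀ x : ZFSet.{u}, (∀ y : ZFSet.{u}, (y ∈ d ∧ pair y x ∈ r) → ZFSet.{u}) → ZFSet.{u} :=
    fun x ih => ZFSet.range (fun y : Shrink.{u} {y : ZFSet.{u} // y ∈ ZFSet.sep (fun y => pair y x ∈ r) d} =>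
      ih ((equivShrink _).symm y).1 (mem_sep.1 ((equivShrink _).symm y).2))
  refine ⟨wf.fix F, fun x _ z => ?_⟩
  rw [wf.fix_eq]
  simp only [F, ZFSet.mem_range]
  constructor
  · rintro ⟨y, rfl⟩
    exact ⟨_, (mem_sep.1 ((equivShrink _).symm y).2).1, (mem_sep.1 ((equivShrink _).symm y).2).2, rfl⟩
  · rintro ⟨y, hy, h, rfl⟩
    exact ⟨equivShrink _ ⟨y, mem_sep.2 ⟨hy, h⟩⟩,
      congrArg (fun w : {y : ZFSet.{u} // y ∈ ZFSet.sep (fun y => pair y x ∈ r) d} => wf.fix F w.1) (Equiv.symm_apply_apply _ _)⟩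

theorem Col.unique {d r : ZFSet.{u}} {p q : ZFSet.{u} → ZFSet.{u}} (hp : Col d r p)
    (hq : Col d r q) : ∀ x ∈ d, p x = q x := by
  have : ∀ a, ∀ x ∈ d, p x = a → p x = q x := by
    intro a
    induction a using ZFSet.inductionOn with
    | _ a ih =>
      rintro x hx rfl
      ext z
      rw [hp x hx, hq x hx]
      refine exists_congr fun y => and_congr_right fun hy => and_congr_right fun h => ?_
      rw [ih (p y) ((hp x hx _).2 ⟨y, hy, h, rfl⟩) y hy rfl]
  exact fun x hx => this _ x hx rfl

/-- Attempts at a collapse. -/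
def Att (M d r t : ZFSet.{u}) : Prop :=
  ∀ x ∈ d, ∀ w ∈ M, pair x w ∈ t → (∀ y ∈ d, pair y x ∈ r → ∃ v ∈ w, pair y v ∈ t) ∧
    ∀ v ∈ w, ∃ y ∈ d, pair y x ∈ r ∧ pair y v ∈ t

instance df_att {E : Type (u + 1)} [Ctx.{u} E] (d r t : E → ZFSet.{u}) [hd : Var d] [hr : Var r]
    [ht : Var t] : Df (fun M e => Att M (d e) (r e) (t e)) := by
  have h1 := hd.prev
  have h2 := hr.prev
  have h3 := ht.prev
  have h4 := h1.prev
  have h5 := h2.prev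
  have h6 := h3.prev
  have h7 := h4.prev
  have h8 := h5.prev
  have h9 := h6.prev
  have i1 := h7.prev
  have i2 := h8.prev
  have i3 := h9.prev
  unfold Att
  infer_instance

theorem Att.eq {M d r t : ZFSet.{u}} (hM : Good M) (htM : t ∈ M) (ht : Att M d r t)
    {p : ZFSet.{u} → ZFSet.{u}}
    (hp : Col d r p) : ∀ x ∈ d, ∀ w, pair x w ∈ t → w = p x := by
  have : ∀ a, ∀ x ∈ d, p x = a → ∀ w, pair x w ∈ t → w = p x := by
    intro a
    induction a using ZFSet.inductionOn with
    | _ a ih =>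
      rintro x hx rfl w hw
      have hwM : w ∈ M := Tr.pair_right hM.tr (hM.tr _ htM hw)
      obtain ⟨h1, h2⟩ := ht x hx w hwM hw
      ext z
      rw [hp x hx]
      constructor
      · intro hz
        obtain ⟨y, hy, h3, h4⟩ := h2 z hz
        exact ⟨y, hy, h3, ih (p y) ((hp x hx _).2 ⟨y, hy, h3, rfl⟩) y hy rfl z h4⟩
      · rintro ⟨y, hy, h3, rfl⟩
        obtain ⟨v, hv, h4⟩ := h1 y hy h3
        rwa [← ih (p y) ((hp x hx _).2 ⟨y, hy, h3, rfl⟩) y hy rfl v h4]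
  exact fun x hx w hw => this _ x hx rfl w hw

theorem mostowski {M d r : ZFSet.{u}} (hM : Good M) (hd : d ∈ M) (hr : r ∈ M)
    {p : ZFSet.{u} → ZFSet.{u}} (hp : Col d r p) :
    ∃ G ∈ M, ∀ z, z ∈ G ↔ ∃ x ∈ d, z = pair x (p x) := by
  have key : ∀ a, ∀ x ∈ d, p x = a → ∃ t ∈ M, Att M d r t ∧ pair x (p x) ∈ t := by
    intro a
    induction a using ZFSet.inductionOn with
    | _ a ih =>
      rintro x hx rfl
      have hxM := hM.tr _ hd hx
      have hs : ZFSet.sep (fun y => pair y x ∈ r) d ∈ M :=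
        hM.sep (fun _ y x r _ _ _ => pair y x ∈ r) hd hxM hr hr hr hr
      have ih' : ∀ y ∈ ZFSet.sep (fun y => pair y x ∈ r) d,
          ∃ t ∈ M, Att M d r t ∧ pair y (p y) ∈ t := by
        intro y hy
        rw [mem_sep] at hy
        exact ih (p y) ((hp x hx _).2 ⟨y, hy.1, hy.2, rfl⟩) y hy.1 rfl
      obtain ⟨T, hT, hT'⟩ := hM.coll' (fun M y t d r _ _ _ => Att M d r t ∧ ∃ w ∈ M, pair y w ∈ t)
        inferInstance _ hs d hd r hr r hr r hr r hr (by
          intro y hy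
          obtain ⟨t, ht, h1, h2⟩ := ih' y hy
          exact ⟨t, ht, h1, p y, Tr.pair_right hM.tr (hM.tr _ ht h2), h2⟩)
      have hT2 : ZFSet.sep (fun t => Att M d r t) T ∈ M :=
        hM.sep (fun M t d r _ _ _ => Att M d r t) hT hd hr hr hr hr
      have ht0 := hM.un _ hT2
      have hA : Att M d r (⋃₀ (ZFSet.sep (fun t => Att M d r t) T)) := by
        intro y hy w hw h
        obtain ⟨t, ht, h⟩ := mem_sUnion.1 h
        obtain ⟨h1, h2⟩ := (mem_sep.1 ht).2 y hy w hw h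
        refine ⟨fun z hz hzy => ?_, fun v hv => ?_⟩
        · obtain ⟨v, hv, h3⟩ := h1 z hz hzy
          exact ⟨v, hv, mem_sUnion.2 ⟨t, ht, h3⟩⟩
        · obtain ⟨z, hz, h3, h4⟩ := h2 v hv
          exact ⟨z, hz, h3, mem_sUnion.2 ⟨t, ht, h4⟩⟩
      have hin : ∀ y ∈ d, pair y x ∈ r → pair y (p y) ∈ ⋃₀ (ZFSet.sep (fun t => Att M d r t) T) := by
        intro y hy hyx
        obtain ⟨t, ht, h1, w, hw, h2⟩ := hT' y (mem_sep.2 ⟨hy, hyx⟩)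
        have := h1.eq hM (hM.tr _ hT ht) hp y hy w h2
        subst this
        exact mem_sUnion.2 ⟨t, mem_sep.2 ⟨ht, h1⟩, h2⟩
      generalize (⋃₀ (ZFSet.sep (fun t => Att M d r t) T)) = t0 at ht0 hA hin
      obtain ⟨q, hq, hq'⟩ := hM.repl (fun M y w t0 _ _ _ _ => pair y w ∈ t0) p hs ht0 ht0 ht0 ht0
        (by
          intro y hy
          rw [mem_sep] at hy
          exact Tr.pair_right hM.tr (hM.tr _ ht0 (hin y hy.1 hy.2)))
        (by
          intro y hy w hw
          rw [mem_sep] at hy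
          refine ⟨hA.eq hM ht0 hp y hy.1 w, ?_⟩
          rintro rfl
          exact hin y hy.1 hy.2)
      have hqp : p x = q := by
        ext z
        rw [hp x hx, hq']
        simp [mem_sep, and_assoc]
      have hpM : p x ∈ M := hqp ▸ hq
      refine ⟨t0 ∪ {pair x (p x)}, hM.union ht0 (hM.singleton (hM.opair hxM hpM)), ?_, by simp⟩
      intro y hy w hw h
      rw [mem_union, mem_singleton] at h
      rcases h with h | h
      · obtain ⟨h1, h2⟩ := hA y hy w hw h
        refine ⟨fun z hz hzy => ?_, fun v hv => ?_⟩
        · obtain ⟨v, hv, h3⟩ := h1 z hz hzy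
          exact ⟨v, hv, mem_union.2 (Or.inl h3)⟩
        · obtain ⟨z, hz, h3, h4⟩ := h2 v hv
          exact ⟨z, hz, h3, mem_union.2 (Or.inl h4)⟩
      · obtain ⟨rfl, rfl⟩ := pair_inj.1 h
        refine ⟨fun z hz hzy => ⟨p z, (hp y hx _).2 ⟨z, hz, hzy, rfl⟩,
          mem_union.2 (Or.inl (hin z hz hzy))⟩, fun v hv => ?_⟩
        obtain ⟨z, hz, h3, rfl⟩ := (hp y hx _).1 hv
        exact ⟨z, hz, h3, mem_union.2 (Or.inl (hin z hz h3))⟩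
  have hpM : ∀ x ∈ d, p x ∈ M := by
    intro x hx
    obtain ⟨t, ht, _, h⟩ := key _ x hx rfl
    exact Tr.pair_right hM.tr (hM.tr _ ht h)
  refine hM.repl (fun M x z d r _ _ _ => ∃ t ∈ M, Att M d r t ∧ z ∈ t ∧ ∃ w ∈ M, z = pair x w)
    (fun x => pair x (p x)) hd hd hr hr hr (fun x hx => hM.opair (hM.tr _ hd hx) (hpM x hx)) ?_
  intro x hx z hz
  constructor
  · rintro ⟨t, ht, h1, h2, w, hw, rfl⟩
    rw [h1.eq hM ht hp x hx w h2]
  · rintro rfl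
    obtain ⟨t, ht, h1, h⟩ := key _ x hx rfl
    exact ⟨t, ht, h1, h, _, hpM x hx, rfl⟩

/-! ## Facts about `κ` and `V_κ` -/

theorem zcard_eq (x : ZFSet.{u}) : zcard x = Cardinal.lift.{u + 1, u} x.card := by
  rw [← ZFSet.cardinalMk_coe_sort]
  exact Cardinal.mk_congr (Equiv.refl _)

theorem IsOrd.ordinal {x : ZFSet.{u}} (h : IsOrd x) : x.IsOrdinal :=
  isOrdinal_iff_forall_mem_isTransitive.2 h

theorem card_image' (f : ZFSet.{u} → ZFSet.{u}) {x y : ZFSet.{u}}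
    (h : ∀ z ∈ y, ∃ w ∈ x, z = f w) : y.card ≤ x.card := by
  let _i := Classical.allZFSetDefinable (fun v : Fin 1 → ZFSet.{u} => f (v 0))
  let : Definable₁ f := _i
  refine le_trans (card_mono (y := ZFSet.image f x) ?_) card_image_le
  intro z hz
  obtain ⟨w, hw, rfl⟩ := h z hz
  exact mem_image.2 ⟨w, hw, rfl⟩

theorem aleph0_le_of_omega {M : ZFSet.{u}} (tr : M.IsTransitive) (h : ZFSet.omega ∈ M) :
    Cardinal.aleph0 ≤ M.card := by
  let f : ℕ → ZFSet.{u} := fun n => Nat.rec ∅ (fun _ x => insert x x) n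
  have hf : ∀ n, f n ∈ ZFSet.omega.{u} := by
    intro n
    induction n with
    | zero => exact omega_zero
    | succ n ih => exact omega_succ ih
  have hmono : StrictMono (fun n => (f n).rank) := by
    refine strictMono_nat_of_lt_succ fun n => rank_lt_of_mem ?_
    show f n ∈ insert (f n) (f n)
    simp
  have hinj : Function.Injective (fun n => (⟨f n, tr _ h (hf n)⟩ : {x // x ∈ M})) := by
    intro m n hmn
    apply hmono.injective
    have := congrArg Subtype.val hmn
    dsimp only at this ⊢
    rw [this]
  have h1 := Cardinal.mk_le_of_injective (Function.Injective.comp hinj ULift.down_injective :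
    Function.Injective ((fun n => (⟨f n, tr _ h (hf n)⟩ : {x // x ∈ M})) ∘ ULift.down.{u+1}))
  have h2 : Cardinal.mk {x // x ∈ M} = Cardinal.lift.{u + 1, u} M.card :=
    ZFSet.cardinalMk_coe_sort
  rw [h2] at h1
  simpa using h1

/-- The situation of a weak `κ`-model containing `V_κ`. -/
structure KV (κ M : ZFSet.{u}) : Prop where
  good : Good M
  ord : κ.IsOrdinal
  lim : Order.IsSuccLimit κ.rank
  eqord : κ.rank = κ.card.ord
  kM : κ ∈ M
  VM : V_ κ.rank ∈ M
  card : M.card = κ.card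
  wo : ∀ x ∈ M, ∃ r ∈ M, IsWellOrderOn x r

theorem kv_of {κ M : ZFSet.{u}} (hκ : IsCard κ) (hM : IsWeakModel κ M) (hV : HasVkappa κ M) :
    KV κ M := by
  obtain ⟨hM, hkM, hc⟩ := hM
  rw [zcard_eq, zcard_eq, Cardinal.lift_inj] at hc
  have ho := hκ.1.ordinal
  have hinf : Cardinal.aleph0 ≤ κ.card := hc ▸ aleph0_le_of_omega hM.1 hM.2.1
  have heq : κ.rank = κ.card.ord := by
    have h1 : κ.card = κ.rank.card := by
      conv_lhs => rw [← ho.toZFSet_rank_eq]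
      rw [Ordinal.card_toZFSet]
    apply le_antisymm
    · by_contra! hlt
      have h2 : κ.card.ord.toZFSet ∈ κ := by
        have := Ordinal.toZFSet_mem_toZFSet_iff.2 hlt
        rwa [ho.toZFSet_rank_eq] at this
      have h3 := hκ.2 _ h2
      rw [zcard_eq, zcard_eq, Cardinal.lift_lt, Ordinal.card_toZFSet, Cardinal.card_ord] at h3
      exact lt_irrefl _ h3
    · rw [h1]; exact Cardinal.ord_card_le _
  refine ⟨good_of_model hM, ho, heq ▸ Cardinal.isSuccLimit_ord hinf, heq, hkM, ?_, hc,
    hM.2.2.2.2.2.2⟩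
  obtain ⟨v, hv, h⟩ := hV
  have : V_ κ.rank = v := by
    ext x; rw [h, mem_vonNeumann]
  rw [this]; exact hv

section kv
variable {κ M : ZFSet.{u}}

theorem KV.card_lt (h : KV κ M) {x : ZFSet.{u}} (hx : x ∈ V_ κ.rank) : x.card < κ.card := by
  have h1 : x.powerset ⊆ M := by
    intro y hy
    refine h.good.tr _ h.VM (mem_vonNeumann.2 ?_)
    exact lt_of_le_of_lt (rank_mono (mem_powerset.1 hy)) (mem_vonNeumann.1 hx)
  have h2 := card_mono h1
  rw [card_powerset, h.card] at h2
  exact lt_of_lt_of_le (Cardinal.cantor _) h2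

theorem KV.pair_mem (h : KV κ M) {x y : ZFSet.{u}} (hx : x ∈ V_ κ.rank) (hy : y ∈ V_ κ.rank) :
    pair x y ∈ V_ κ.rank := by
  rw [mem_vonNeumann] at *
  have : ∀ {a}, a < κ.rank → Order.succ a < κ.rank := fun ha => h.lim.succ_lt ha
  simp only [pair, rank_pair, rank_singleton, max_lt_iff]
  exact ⟨this (this hx), this (max_lt (this hx) (this hy))⟩

theorem KV.k_sub (_ : KV κ M) : κ ⊆ V_ κ.rank := fun _ hx => mem_vonNeumann.2 (rank_lt_of_mem hx)

theorem KV.mem_k (h : KV κ M) {y : ZFSet.{u}} (hy : y.IsOrdinal) (hc : y.card < κ.card) :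
    y ∈ κ := by
  rw [← hy.rank_lt_iff_mem h.ord, h.eqord, Cardinal.lt_ord]
  rwa [← Ordinal.card_toZFSet, hy.toZFSet_rank_eq]

theorem KV.ordCollapse (h : KV κ M) {d r : ZFSet.{u}} {p : ZFSet.{u} → ZFSet.{u}}
    (hp : Col d r p)
    (tr : ∀ x ∈ d, ∀ y ∈ d, ∀ z ∈ d, pair x y ∈ r → pair y z ∈ r → pair x z ∈ r)
    (tri : ∀ x ∈ d, ∀ y ∈ d, x = y ∨ pair x y ∈ r ∨ pair y x ∈ r)
    (sm : ∀ x ∈ d, ∃ s ∈ V_ κ.rank, ∀ y ∈ d, pair y x ∈ r → y ∈ s) :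
    (∀ x ∈ d, p x ∈ κ) ∧ ∀ x ∈ d, ∀ y ∈ d, p x = p y → x = y := by
  have t : ∀ x ∈ d, (p x).IsTransitive := by
    intro x hx z hz w hw
    obtain ⟨y, hy, hyx, rfl⟩ := (hp x hx z).1 hz
    obtain ⟨y', hy', hyx', rfl⟩ := (hp y hy w).1 hw
    exact (hp x hx _).2 ⟨y', hy', tr _ hy' _ hy _ hx hyx' hyx, rfl⟩
  constructor
  · intro x hx
    apply h.mem_k
    · refine isOrdinal_iff_forall_mem_isTransitive.2 ⟨t x hx, fun y hy => ?_⟩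
      obtain ⟨y, hy', hyx, rfl⟩ := (hp x hx y).1 hy
      exact t y hy'
    · obtain ⟨s, hs, h1⟩ := sm x hx
      refine lt_of_le_of_lt (card_image' p ?_) (h.card_lt hs)
      intro z hz
      obtain ⟨y, hy, hyx, rfl⟩ := (hp x hx z).1 hz
      exact ⟨y, h1 y hy hyx, rfl⟩
  · intro x hx y hy hxy
    rcases tri x hx y hy with h1 | h1 | h1
    · exact h1
    · have := (hp y hy _).2 ⟨x, hx, h1, rfl⟩
      rw [hxy] at this
      exact absurd this (mem_irrefl _)
    · have := (hp x hx _).2 ⟨y, hy, h1, rfl⟩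
      rw [hxy] at this
      exact absurd this (mem_irrefl _)

end kv

/-! ### Gödel pairing -/

/-- Gödel's ordering of pairs of ordinals. -/
def glt (a b c d : ZFSet.{u}) : Prop :=
  ((a ∈ c ∨ a ∈ d) ∧ (b ∈ c ∨ b ∈ d)) ∨
  (¬ ((c ∈ a ∨ c ∈ b) ∧ (d ∈ a ∨ d ∈ b)) ∧ (a ∈ c ∨ (a = c ∧ b ∈ d)))

theorem glt_iff {κ a b c d : ZFSet.{u}} (hκ : κ.IsOrdinal) (ha : a ∈ κ) (hb : b ∈ κ)
    (hc : c ∈ κ) (hd : d ∈ κ) : glt a b c d ↔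
      toLex (max a.rank b.rank, toLex (a.rank, b.rank)) <
        toLex (max c.rank d.rank, toLex (c.rank, d.rank)) := by
  have oa := hκ.mem ha
  have ob := hκ.mem hb
  have oc := hκ.mem hc
  have od := hκ.mem hd
  have e : a = c ↔ a.rank = c.rank := (oa.rank_inj oc).symm
  unfold glt
  rw [← oa.rank_lt_iff_mem oc, ← oa.rank_lt_iff_mem od, ← ob.rank_lt_iff_mem oc,
    ← ob.rank_lt_iff_mem od, ← oc.rank_lt_iff_mem oa, ← oc.rank_lt_iff_mem ob,
    ← od.rank_lt_iff_mem oa, ← od.rank_lt_iff_mem ob, e]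
  generalize a.rank = a
  generalize b.rank = b
  generalize c.rank = c
  generalize d.rank = d
  simp only [Prod.Lex.toLex_lt_toLex]
  rw [max_lt_iff, lt_max_iff, lt_max_iff]
  constructor
  · rintro (h | ⟨h1, h2⟩)
    · exact Or.inl h
    · by_cases h3 : max a b < max c d
      · left; rwa [max_lt_iff, lt_max_iff, lt_max_iff] at h3
      · right
        refine ⟨le_antisymm ?_ (not_lt.1 h3), h2⟩
        rw [← lt_max_iff, ← lt_max_iff, ← max_lt_iff, not_lt] at h1
        exact h1
  · rintro (h | ⟨h1, h2⟩)
    · exact Or.inl h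
    · right
      refine ⟨?_, h2⟩
      rw [← lt_max_iff, ← lt_max_iff, ← max_lt_iff, h1]
      exact lt_irrefl _

/-- The set coding Gödel's ordering on `κ × κ`. -/
def gset (κ : ZFSet.{u}) : ZFSet.{u} :=
  ZFSet.sep (fun z => ∃ a ∈ κ, ∃ b ∈ κ, ∃ c ∈ κ, ∃ d ∈ κ, glt a b c d ∧
    z = pair (pair a b) (pair c d)) ((κ.prod κ).prod (κ.prod κ))

theorem mem_gset {κ a b c d : ZFSet.{u}} (ha : a ∈ κ) (hb : b ∈ κ)
    (hc : c ∈ κ) (hd : d ∈ κ) : pair (pair a b) (pair c d) ∈ gset κ ↔ glt a b c d := by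
  unfold gset
  rw [mem_sep]
  constructor
  · rintro ⟨-, a', -, b', -, c', -, d', -, h, e⟩
    simp only [pair_inj] at e
    obtain ⟨⟨rfl, rfl⟩, rfl, rfl⟩ := e
    exact h
  · intro h
    exact ⟨by simp [*], a, ha, b, hb, c, hc, d, hd, h, rfl⟩

theorem gset_mem {κ M : ZFSet.{u}} (hM : Good M) (hκ : κ ∈ M) : gset κ ∈ M := by
  have h1 := hM.prod hκ hκ
  have h2 := hM.prod h1 h1
  have h3 := hM.sep (fun M z κ _ _ _ _ => ∃ a ∈ κ, ∃ b ∈ κ, ∃ c ∈ κ, ∃ d ∈ κ,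
    (((a ∈ c ∨ a ∈ d) ∧ (b ∈ c ∨ b ∈ d)) ∨
    (¬ ((c ∈ a ∨ c ∈ b) ∧ (d ∈ a ∨ d ∈ b)) ∧ (a ∈ c ∨ (a = c ∧ b ∈ d)))) ∧
    ∃ x ∈ M, ∃ y ∈ M, x = pair a b ∧ y = pair c d ∧ z = pair x y) h2 hκ hκ hκ hκ hκ
  convert h3 using 1
  unfold gset glt
  ext z
  rw [mem_sep, mem_sep]
  refine and_congr_right fun _ => ?_
  refine exists_congr fun a => and_congr_right fun ha => ?_
  refine exists_congr fun b => and_congr_right fun hb => ?_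
  refine exists_congr fun c => and_congr_right fun hc => ?_
  refine exists_congr fun d => and_congr_right fun hd => and_congr_right fun _ => ?_
  have := hM.tr _ hκ
  constructor
  · rintro rfl
    exact ⟨_, hM.opair (this ha) (this hb), _, hM.opair (this hc) (this hd), rfl, rfl, rfl⟩
  · rintro ⟨x, _, y, _, rfl, rfl, rfl⟩
    rfl

/-- A function on pairs of sets read off as a function of sets. -/
theorem pair_fun {α : Type*} [Inhabited α] (g : ZFSet.{u} → ZFSet.{u} → α) :
    ∃ f : ZFSet.{u} → α, ∀ a b, f (pair a b) = g a b := by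
  refine ⟨fun z => if h : ∃ ab : ZFSet.{u} × ZFSet.{u}, z = pair ab.1 ab.2 then
    g h.choose.1 h.choose.2 else default, fun a b => ?_⟩
  have h : ∃ ab : ZFSet.{u} × ZFSet.{u}, pair a b = pair ab.1 ab.2 := ⟨(a, b), rfl⟩
  dsimp only
  rw [dif_pos h]
  have := h.choose_spec
  rw [pair_inj] at this
  rw [← this.1, ← this.2]

theorem KV.godel {κ M : ZFSet.{u}} (h : KV κ M) : ∃ (p : ZFSet.{u} → ZFSet.{u} → ZFSet.{u})
    (G : ZFSet.{u}),
    (∀ a ∈ κ, ∀ b ∈ κ, ∀ c, pair (pair a b) c ∈ G ↔ c = p a b) ∧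
    (∀ N, Good N → κ ∈ N → G ∈ N) ∧ (∀ a ∈ κ, ∀ b ∈ κ, p a b ∈ κ) ∧
    (∀ a ∈ κ, ∀ b ∈ κ, ∀ c ∈ κ, ∀ d ∈ κ, p a b = p c d → a = c ∧ b = d) := by
  obtain ⟨f, hf⟩ := pair_fun (fun a b : ZFSet.{u} =>
    toLex (max a.rank b.rank, toLex (a.rank, b.rank)))
  have hlt : ∀ x ∈ κ.prod κ, ∀ y ∈ κ.prod κ, pair x y ∈ gset κ ↔ f x < f y := by
    intro x hx y hy
    obtain ⟨a, ha, b, hb, rfl⟩ := mem_prod.1 hx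
    obtain ⟨c, hc, d, hd, rfl⟩ := mem_prod.1 hy
    rw [mem_gset ha hb hc hd, glt_iff h.ord ha hb hc hd, hf, hf]
  have hsub : ∀ x y, pair x y ∈ gset κ → y ∈ κ.prod κ := by
    intro x y hxy
    exact (pair_mem_prod.1 (mem_sep.1 hxy).1).2
  have wf : WellFounded (fun y x : ZFSet.{u} => y ∈ κ.prod κ ∧ pair y x ∈ gset κ) :=
    Subrelation.wf (fun {y x} hyx => (hlt y hyx.1 x (hsub _ _ hyx.2)).1 hyx.2)
      (InvImage.wf f wellFounded_lt)
  obtain ⟨q, hq⟩ := col_exists wf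
  obtain ⟨h1, h2⟩ := h.ordCollapse hq
    (fun x hx y hy z hz hxy hyz => by
      rw [hlt _ hx _ hy] at hxy
      rw [hlt _ hy _ hz] at hyz
      rw [hlt _ hx _ hz]
      exact hxy.trans hyz)
    (fun x hx y hy => by
      rw [hlt _ hx _ hy, hlt _ hy _ hx]
      rcases lt_trichotomy (f x) (f y) with h3 | h3 | h3
      · exact Or.inr (Or.inl h3)
      · left
        obtain ⟨a, ha, b, hb, rfl⟩ := mem_prod.1 hx
        obtain ⟨c, hc, d, hd, rfl⟩ := mem_prod.1 hy
        rw [hf, hf] at h3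
        simp only [toLex_inj, Prod.mk.injEq] at h3
        rw [((h.ord.mem ha).rank_inj (h.ord.mem hc)).1 h3.2.1,
          ((h.ord.mem hb).rank_inj (h.ord.mem hd)).1 h3.2.2]
      · exact Or.inr (Or.inr h3))
    (fun x hx => by
      obtain ⟨a, ha, b, hb, rfl⟩ := mem_prod.1 hx
      have hs : ∀ {o}, o < κ.rank → Order.succ o < κ.rank := fun ho => h.lim.succ_lt ho
      refine ⟨V_ (Order.succ (Order.succ (Order.succ (max a.rank b.rank)))), ?_, ?_⟩
      · rw [mem_vonNeumann, rank_vonNeumann]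
        exact hs (hs (hs (max_lt (rank_lt_of_mem ha) (rank_lt_of_mem hb))))
      · intro y hy hyx
        rw [hlt _ hy _ hx] at hyx
        obtain ⟨c, hc, d, hd, rfl⟩ := mem_prod.1 hy
        rw [hf, hf, Prod.Lex.toLex_lt_toLex] at hyx
        have h3 : max c.rank d.rank ≤ max a.rank b.rank := by
          rcases hyx with h3 | h3
          · exact h3.le
          · exact h3.1.le
        have hc' := (le_max_left _ _).trans h3
        have hd' := (le_max_right _ _).trans h3
        rw [mem_vonNeumann]
        simp only [pair, rank_pair, rank_singleton, max_le_iff, Order.succ_le_succ_iff,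
          Order.lt_succ_iff]
        exact ⟨hc', hc', hd'⟩)
  obtain ⟨G, hG, hG'⟩ := mostowski h.good (h.good.prod h.kM h.kM) (gset_mem h.good h.kM) hq
  refine ⟨fun a b => q (pair a b), G, ?_, ?_, ?_, ?_⟩
  · intro a ha b hb c
    rw [hG']
    constructor
    · rintro ⟨x, hx, e⟩
      obtain ⟨rfl, rfl⟩ := pair_inj.1 e
      rfl
    · rintro rfl
      exact ⟨_, pair_mem_prod.2 ⟨ha, hb⟩, rfl⟩
  · intro N hN hκ
    obtain ⟨G', hG1, hG2⟩ := mostowski hN (hN.prod hκ hκ) (gset_mem hN hκ) hq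
    have : G = G' := by ext z; rw [hG', hG2]
    rw [this]; exact hG1
  · exact fun a ha b hb => h1 _ (pair_mem_prod.2 ⟨ha, hb⟩)
  · intro a ha b hb c hc d hd e
    exact pair_inj.1 (h2 _ (pair_mem_prod.2 ⟨ha, hb⟩) _ (pair_mem_prod.2 ⟨hc, hd⟩) e)

/-! ## An injection of `V_κ` into `κ` inside the model -/

theorem KV.rankFun {κ M : ZFSet.{u}} (h : KV κ M) : ∃ (p : ZFSet.{u} → ZFSet.{u}), ∃ G ∈ M,
    (∀ z, z ∈ G ↔ ∃ x ∈ V_ κ.rank, z = pair x (p x)) ∧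
    (∀ x ∈ V_ κ.rank, (p x).IsOrdinal ∧ (p x).rank = x.rank) := by
  have hVM := h.VM
  have hVt : (V_ κ.rank).IsTransitive := isTransitive_vonNeumann _
  set V := V_ κ.rank with hV
  have hR : ZFSet.sep (fun z => ∃ x ∈ V, ∃ y ∈ V, z = pair x y ∧
      ∀ t ∈ V, (∀ a ∈ t, a ⊆ t) → y ⊆ t → x ∈ t) (V.prod V) ∈ M :=
    h.good.sep (fun M z V _ _ _ _ => ∃ x ∈ V, ∃ y ∈ V, z = pair x y ∧
      ∀ t ∈ V, (∀ a ∈ t, a ⊆ t) → y ⊆ t → x ∈ t) (h.good.prod hVM hVM) hVM hVM hVM hVM hVM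
  have memR : ∀ x y, pair x y ∈ ZFSet.sep (fun z => ∃ x ∈ V, ∃ y ∈ V, z = pair x y ∧
      ∀ t ∈ V, (∀ a ∈ t, a ⊆ t) → y ⊆ t → x ∈ t) (V.prod V) ↔ x ∈ V ∧ y ∈ V ∧
      ∀ t ∈ V, (∀ a ∈ t, a ⊆ t) → y ⊆ t → x ∈ t := by
    intro x y
    rw [mem_sep]
    constructor
    · rintro ⟨-, x', hx, y', hy, e, h1⟩
      obtain ⟨rfl, rfl⟩ := pair_inj.1 e
      exact ⟨hx, hy, h1⟩
    · rintro ⟨hx, hy, h1⟩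
      exact ⟨pair_mem_prod.2 ⟨hx, hy⟩, x, hx, y, hy, rfl, h1⟩
  generalize (ZFSet.sep (fun z => ∃ x ∈ V, ∃ y ∈ V, z = pair x y ∧
      ∀ t ∈ V, (∀ a ∈ t, a ⊆ t) → y ⊆ t → x ∈ t) (V.prod V)) = R at hR memR
  have hlt : ∀ x y, pair x y ∈ R → x.rank < y.rank := by
    intro x y hxy
    obtain ⟨hx, hy, h1⟩ := (memR x y).1 hxy
    refine mem_vonNeumann.1 (h1 (V_ y.rank) ?_ ?_ ?_)
    · rw [hV, mem_vonNeumann, rank_vonNeumann]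
      exact mem_vonNeumann.1 hy
    · exact isTransitive_vonNeumann _
    · intro z hz
      exact mem_vonNeumann.2 (rank_lt_of_mem hz)
  have hmem : ∀ x y, y ∈ V → x ∈ y → pair x y ∈ R := by
    intro x y hy hxy
    exact (memR _ _).2 ⟨hVt _ hy hxy, hy, fun t _ _ h2 => h2 hxy⟩
  have htr : ∀ x y z, pair x y ∈ R → pair y z ∈ R → pair x z ∈ R := by
    intro x y z hxy hyz
    rw [memR] at *
    refine ⟨hxy.1, hyz.2.1, fun t ht h1 h2 => ?_⟩
    exact hxy.2.2 t ht h1 (h1 _ (hyz.2.2 t ht h1 h2))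
  have wf : WellFounded (fun y x : ZFSet.{u} => y ∈ V ∧ pair y x ∈ R) :=
    Subrelation.wf (fun {y x} hyx => hlt y x hyx.2) (InvImage.wf ZFSet.rank wellFounded_lt)
  obtain ⟨p, hp⟩ := col_exists wf
  obtain ⟨G, hG, hG'⟩ := mostowski h.good hVM hR hp
  have t : ∀ x ∈ V, (p x).IsTransitive := by
    intro x hx z hz w hw
    obtain ⟨y, hy, hyx, rfl⟩ := (hp x hx z).1 hz
    obtain ⟨y', hy', hyx', rfl⟩ := (hp y hy w).1 hw
    exact (hp x hx _).2 ⟨y', hy', htr _ _ _ hyx' hyx, rfl⟩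
  refine ⟨p, G, hG, hG', fun x hx => ⟨?_, ?_⟩⟩
  · refine isOrdinal_iff_forall_mem_isTransitive.2 ⟨t x hx, fun y hy => ?_⟩
    obtain ⟨y, hy', hyx, rfl⟩ := (hp x hx y).1 hy
    exact t y hy'
  · have : ∀ o : Ordinal.{u}, ∀ x ∈ V, x.rank = o → (p x).rank = x.rank := by
      intro o
      induction o using WellFoundedLT.induction with
      | _ o ih =>
        rintro x hx rfl
        apply le_antisymm
        · rw [rank_le_iff]
          intro z hz
          obtain ⟨y, hy, hyx, rfl⟩ := (hp x hx z).1 hz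
          have h1 := hlt _ _ hyx
          rw [ih _ h1 y hy rfl]
          exact h1
        · rw [rank_le_iff]
          intro y hy
          have h1 := hmem y x hx hy
          have h2 := hlt _ _ h1
          rw [← ih _ h2 y (hVt _ hx hy) rfl]
          exact rank_lt_of_mem ((hp x hx _).2 ⟨y, hVt _ hx hy, h1, rfl⟩)
    exact this _ x hx rfl

theorem KV.inj {κ M : ZFSet.{u}} (h : KV κ M) : ∃ (o : ZFSet.{u} → ZFSet.{u}), ∃ O ∈ M,
    (∀ z, z ∈ O ↔ ∃ x ∈ V_ κ.rank, z = pair x (o x)) ∧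
    (∀ x ∈ V_ κ.rank, o x ∈ κ) ∧ ∀ x ∈ V_ κ.rank, ∀ y ∈ V_ κ.rank, o x = o y → x = y := by
  have hVM := h.VM
  obtain ⟨p, G, hG, hG', hp⟩ := h.rankFun
  obtain ⟨r, hr, -, rtri, rtr, rirr, rmin⟩ := h.wo _ h.VM
  have hs : ∀ {a}, a < κ.rank → Order.succ a < κ.rank := fun ha => h.lim.succ_lt ha
  set V := V_ κ.rank with hV
  have hQ := h.good.sep (fun M z V G r _ _ => ∃ x ∈ V, ∃ y ∈ V, z = pair x y ∧ ∃ a ∈ M, ∃ b ∈ M,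
    pair x a ∈ G ∧ pair y b ∈ G ∧ (a ∈ b ∨ (a = b ∧ pair x y ∈ r))) (h.good.prod hVM hVM)
    hVM hG hr hr hr
  have memQ : ∀ x ∈ V, ∀ y ∈ V, pair x y ∈ ZFSet.sep (fun z => ∃ x ∈ V, ∃ y ∈ V, z = pair x y ∧
      ∃ a ∈ M, ∃ b ∈ M, pair x a ∈ G ∧ pair y b ∈ G ∧ (a ∈ b ∨ (a = b ∧ pair x y ∈ r)))
      (V.prod V) ↔ x.rank < y.rank ∨ (x.rank = y.rank ∧ pair x y ∈ r) := by
    intro x hx y hy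
    obtain ⟨ox, rx⟩ := hp x hx
    obtain ⟨oy, ry⟩ := hp y hy
    rw [← rx, ← ry, ox.rank_lt_iff_mem oy, ox.rank_inj oy, mem_sep]
    constructor
    · rintro ⟨-, x', hx', y', hy', e, a, ha, b, hb, h1, h2, h3⟩
      obtain ⟨rfl, rfl⟩ := pair_inj.1 e
      obtain ⟨x', -, e⟩ := (hG' _).1 h1
      obtain ⟨rfl, rfl⟩ := pair_inj.1 e
      obtain ⟨y', -, e⟩ := (hG' _).1 h2
      obtain ⟨rfl, rfl⟩ := pair_inj.1 e
      exact h3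
    · intro h3
      have h1 := (hG' _).2 ⟨x, hx, rfl⟩
      have h2 := (hG' _).2 ⟨y, hy, rfl⟩
      exact ⟨pair_mem_prod.2 ⟨hx, hy⟩, x, hx, y, hy, rfl, p x,
        Tr.pair_right h.good.tr (h.good.tr _ hG h1), p y,
        Tr.pair_right h.good.tr (h.good.tr _ hG h2), h1, h2, h3⟩
  have Qsub : ∀ x y, pair x y ∈ ZFSet.sep (fun z => ∃ x ∈ V, ∃ y ∈ V, z = pair x y ∧
      ∃ a ∈ M, ∃ b ∈ M, pair x a ∈ G ∧ pair y b ∈ G ∧ (a ∈ b ∨ (a = b ∧ pair x y ∈ r)))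
      (V.prod V) → y ∈ V := fun x y hxy => (pair_mem_prod.1 (mem_sep.1 hxy).1).2
  generalize (ZFSet.sep (fun z => ∃ x ∈ V, ∃ y ∈ V, z = pair x y ∧
      ∃ a ∈ M, ∃ b ∈ M, pair x a ∈ G ∧ pair y b ∈ G ∧ (a ∈ b ∨ (a = b ∧ pair x y ∈ r)))
      (V.prod V)) = Q at hQ memQ Qsub
  have wf : WellFounded (fun y x : ZFSet.{u} => y ∈ V ∧ pair y x ∈ Q) := by
    rw [WellFounded.wellFounded_iff_has_min]
    intro S hS
    by_cases hne : ∃ x ∈ S, x ∈ V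
    · obtain ⟨x0, hx0, hx0V⟩ := hne
      obtain ⟨m, ⟨hmS, hmV⟩, hm⟩ := (InvImage.wf ZFSet.rank.{u} wellFounded_lt).has_min
        {x | x ∈ S ∧ x ∈ V} ⟨x0, hx0, hx0V⟩
      obtain ⟨a, ⟨haS, haV, har⟩, ha⟩ := rmin {x | x ∈ S ∧ x ∈ V ∧ x.rank = m.rank}
        (fun x hx => hx.2.1) ⟨m, hmS, hmV, rfl⟩
      refine ⟨a, haS, fun y hy hya => ?_⟩
      rcases (memQ y hya.1 a haV).1 hya.2 with h1 | ⟨h1, h2⟩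
      · exact hm y ⟨hy, hya.1⟩ (show y.rank < m.rank from har ▸ h1)
      · exact ha y ⟨hy, hya.1, h1.trans har⟩ h2
    · obtain ⟨x, hx⟩ := hS
      exact ⟨x, hx, fun y hy hyx => hne ⟨y, hy, hyx.1⟩⟩
  obtain ⟨o, ho⟩ := col_exists wf
  obtain ⟨O, hO, hO'⟩ := mostowski h.good hVM hQ ho
  refine ⟨o, O, hO, hO', h.ordCollapse ho ?_ ?_ ?_⟩
  · intro x hx y hy z hz hxy hyz
    rw [memQ _ hx _ hy] at hxy
    rw [memQ _ hy _ hz] at hyz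
    rw [memQ _ hx _ hz]
    rcases hxy with h1 | ⟨h1, h2⟩ <;> rcases hyz with h3 | ⟨h3, h4⟩
    · exact Or.inl (h1.trans h3)
    · exact Or.inl (h3 ▸ h1)
    · exact Or.inl (h1 ▸ h3)
    · exact Or.inr ⟨h1.trans h3, rtr _ hx _ hy _ hz h2 h4⟩
  · intro x hx y hy
    rw [memQ _ hx _ hy, memQ _ hy _ hx]
    rcases lt_trichotomy x.rank y.rank with h1 | h1 | h1
    · exact Or.inr (Or.inl (Or.inl h1))
    · rcases rtri x hx y hy with h2 | h2 | h2
      · exact Or.inl h2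
      · exact Or.inr (Or.inl (Or.inr ⟨h1, h2⟩))
      · exact Or.inr (Or.inr (Or.inr ⟨h1.symm, h2⟩))
    · exact Or.inr (Or.inr (Or.inl h1))
  · intro x hx
    refine ⟨V_ (Order.succ x.rank), ?_, ?_⟩
    · rw [mem_vonNeumann, rank_vonNeumann]
      exact hs (mem_vonNeumann.1 hx)
    · intro y hy hyx
      rw [mem_vonNeumann, Order.lt_succ_iff]
      rcases (memQ _ hy _ hx).1 hyx with h1 | h1
      · exact h1.le
      · exact h1.1.le

/-! ## The image of `V_κ` under an elementary embedding -/

/-- First-order properties of `j(V_κ)` in the target model `N`. -/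
structure RR (κ N R : ZFSet.{u}) : Prop where
  good : Good N
  RN : R ∈ N
  kR : κ ∈ R
  tr : ∀ x ∈ R, x ⊆ R
  pr : ∀ x ∈ R, ∀ y ∈ R, ∃ z ∈ R, z = pair x y
  bdd : ∀ a ∈ R, ∀ x ∈ N, (∀ y ∈ x, y ⊆ a) → x ∈ R
  pw : ∀ a ∈ R, ∃ q ∈ R, ∀ x ∈ N, x ⊆ a → x ∈ q
  surj : ∀ d ∈ R, ∀ t ∈ N, ∀ s ∈ N,
    (∀ x ∈ d, ∀ z ∈ N, ∀ w ∈ N, pair x z ∈ t → pair x w ∈ t → z = w) →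
    (∀ z ∈ s, ∃ x ∈ d, pair x z ∈ t) → (∀ y ∈ s, y ⊆ s) → s ∈ R

theorem exists_rank_eq {s : ZFSet.{u}} (hs : s.IsTransitive) {o : Ordinal.{u}} (ho : o < s.rank) :
    ∃ x ∈ s, x.rank = o := by
  obtain ⟨y, ⟨hy, hoy⟩, hmin⟩ := (InvImage.wf ZFSet.rank.{u} wellFounded_lt).has_min
    {y | y ∈ s ∧ o ≤ y.rank} (by
      obtain ⟨y, hy, h⟩ := lt_rank_iff.1 ho
      exact ⟨y, hy, h⟩)
  refine ⟨y, hy, ?_⟩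
  by_contra hne
  obtain ⟨z, hz, h⟩ := lt_rank_iff.1 (lt_of_le_of_ne hoy (Ne.symm hne))
  exact hmin z ⟨hs _ hy hz, h⟩ (rank_lt_of_mem hz)

theorem KV.rr {κ M N : ZFSet.{u}} {j : ZFSet.{u} → ZFSet.{u}} (h : KV κ M) (hj : Elem M N j)
    (hk : κ ∈ j κ) : RR κ N (j (V_ κ.rank)) := by
  have hV := h.VM
  have hkM := h.kM
  have hs : ∀ {a}, a < κ.rank → Order.succ a < κ.rank := fun ha => h.lim.succ_lt ha
  refine ⟨good_of_elem hj h.good hkM, hj.maps _ hV, ?_, ?_, ?_, ?_, ?_, ?_⟩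
  · exact (hj.elem (fun _ κ V _ _ _ => κ ⊆ V) hkM hV hV hV hV).1 h.k_sub hk
  · exact (hj.elem (fun _ V _ _ _ _ => ∀ x ∈ V, x ⊆ V) hV hV hV hV hV).1
      (isTransitive_vonNeumann _)
  · exact (hj.elem (fun _ V _ _ _ _ => ∀ x ∈ V, ∀ y ∈ V, ∃ z ∈ V, z = pair x y) hV hV hV hV hV).1
      (fun x hx y hy => ⟨_, h.pair_mem hx hy, rfl⟩)
  · refine (hj.elem (fun M V _ _ _ _ => ∀ a ∈ V, ∀ x ∈ M, (∀ y ∈ x, y ⊆ a) → x ∈ V)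
      hV hV hV hV hV).1 ?_
    intro a ha x _ hx
    rw [mem_vonNeumann] at *
    refine lt_of_le_of_lt (rank_le_iff.2 ?_) (hs ha)
    intro y hy
    exact Order.lt_succ_of_le (rank_mono (hx y hy))
  · refine (hj.elem (fun M V _ _ _ _ => ∀ a ∈ V, ∃ q ∈ V, ∀ x ∈ M, x ⊆ a → x ∈ q)
      hV hV hV hV hV).1 ?_
    intro a ha
    refine ⟨a.powerset, ?_, fun x _ hx => mem_powerset.2 hx⟩
    rw [mem_vonNeumann] at *
    rw [rank_powerset]
    exact hs ha
  · refine (hj.elem (fun N R _ _ _ _ => ∀ d ∈ R, ∀ t ∈ N, ∀ s ∈ N,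
      (∀ x ∈ d, ∀ z ∈ N, ∀ w ∈ N, pair x z ∈ t → pair x w ∈ t → z = w) →
      (∀ z ∈ s, ∃ x ∈ d, pair x z ∈ t) → (∀ y ∈ s, y ⊆ s) → s ∈ R) hV hV hV hV hV).1 ?_
    intro d hd t _ s hsM hfun hsurj htr
    have h1 : s.card ≤ d.card := by
      refine card_image' (fun x => if h : ∃ z ∈ s, pair x z ∈ t then h.choose else ∅) ?_
      intro z hz
      obtain ⟨x, hx, hxz⟩ := hsurj z hz
      have h2 : ∃ z ∈ s, pair x z ∈ t := ⟨z, hz, hxz⟩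
      refine ⟨x, hx, ?_⟩
      rw [dif_pos h2]
      have h3 := h2.choose_spec
      exact hfun x hx _ (h.good.tr _ hsM hz) _ (h.good.tr _ hsM h3.1) hxz h3.2
    have h2 : s.rank.card ≤ s.card := by
      rw [← Ordinal.card_toZFSet]
      refine card_image' (fun x => x.rank.toZFSet) ?_
      intro z hz
      obtain ⟨o, ho, rfl⟩ := Ordinal.mem_toZFSet_iff.1 hz
      obtain ⟨x, hx, hxo⟩ := exists_rank_eq htr ho
      exact ⟨x, hx, by rw [hxo]⟩
    rw [mem_vonNeumann, h.eqord, Cardinal.lt_ord]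
    exact lt_of_le_of_lt (h2.trans h1) (h.card_lt hd)

/-- `f ⊆ V` is a functional set of pairs. -/
def Fn (V f : ZFSet.{u}) : Prop :=
  f ⊆ V ∧ ∀ x ∈ V, ∀ y ∈ V, ∀ z ∈ V, pair x y ∈ f → pair x z ∈ f → y = z

instance df_fn {E : Type (u + 1)} [Ctx.{u} E] (V f : E → ZFSet.{u}) [hV : Var V] [hf : Var f] :
    Df (fun _ e => Fn (V e) (f e)) := by
  have h1 := hV.prev
  have h2 := hf.prev
  have h3 := h1.prev
  have h4 := h2.prev
  have h5 := h3.prev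
  have h6 := h4.prev
  unfold Fn
  infer_instance

/-- The functions of the first model are uniformly a member of `R`. -/
theorem functions_mem {κ M U N R : ZFSet.{u}} (h : KV κ M) (hU : IsMUltrafilter κ M U)
    (hR : RR κ N R) (hUN : U ∈ N) :
    V_ κ.rank ∈ R ∧ ∃ F ∈ R, ∀ f, f ∈ F ↔ f ∈ M ∧ Fn (V_ κ.rank) f := by
  have hN := hR.good
  have hkN : κ ∈ N := hN.tr _ hR.RN hR.kR
  have hVM := h.VM
  have hkM := h.kM
  have hVt : (V_ κ.rank).IsTransitive := isTransitive_vonNeumann _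
  obtain ⟨p, G, hG, hGN, hpk, hpinj⟩ := h.godel
  obtain ⟨o, O, hO, hO', hok, hoinj⟩ := h.inj
  have hGM := hGN M h.good hkM
  have hGN' := hGN N hN hkN
  set V := V_ κ.rank with hVdef
  have memO : ∀ x a, pair x a ∈ O ↔ x ∈ V ∧ a = o x := by
    intro x a
    rw [hO']
    constructor
    · rintro ⟨y, hy, e⟩
      obtain ⟨rfl, rfl⟩ := pair_inj.1 e
      exact ⟨hy, rfl⟩
    · rintro ⟨hx, rfl⟩
      exact ⟨x, hx, rfl⟩
  -- subsets of `κ` in `M` belong to `N`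
  have sub : ∀ A ∈ M, A ⊆ κ → A ∈ N := by
    intro A hA hAk
    rcases hU.2.2.2.2.2.1 A hA hAk with h1 | h1
    · exact hN.tr _ hUN h1
    · have h2 := hN.tr _ hUN h1
      have h3 := hN.sep (fun _ x A _ _ _ _ => x ∉ A) hkN h2 h2 h2 h2 h2
      convert h3 using 1
      ext x
      rw [mem_sep, compl, mem_sep]
      constructor
      · intro hx
        exact ⟨hAk hx, fun h4 => h4.2 hx⟩
      · rintro ⟨hx, h4⟩
        by_contra h5
        exact h4 ⟨hx, h5⟩
  -- the code of `V`
  have hY : ZFSet.sep (fun a => ∃ x ∈ V, pair x a ∈ O) κ ∈ N :=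
    sub _ (h.good.sep (fun _ a V O _ _ _ => ∃ x ∈ V, pair x a ∈ O) hkM hVM hO hO hO hO)
      (fun x hx => (mem_sep.1 hx).1)
  have memY : ∀ a, a ∈ ZFSet.sep (fun a => ∃ x ∈ V, pair x a ∈ O) κ ↔ ∃ x ∈ V, a = o x := by
    intro a
    rw [mem_sep]
    constructor
    · rintro ⟨-, x, hx, h1⟩
      exact ⟨x, hx, ((memO _ _).1 h1).2⟩
    · rintro ⟨x, hx, rfl⟩
      exact ⟨hok x hx, x, hx, (memO _ _).2 ⟨hx, rfl⟩⟩
  generalize (ZFSet.sep (fun a => ∃ x ∈ V, pair x a ∈ O) κ) = Y at hY memY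
  have hX : ZFSet.sep (fun c => ∃ x ∈ V, ∃ y ∈ V, x ∈ y ∧ ∃ a ∈ κ, ∃ b ∈ κ, pair x a ∈ O ∧
      pair y b ∈ O ∧ ∃ q ∈ M, q = pair a b ∧ pair q c ∈ G) κ ∈ N :=
    sub _ (h.good.sep (fun M c V O G κ _ => ∃ x ∈ V, ∃ y ∈ V, x ∈ y ∧ ∃ a ∈ κ, ∃ b ∈ κ,
      pair x a ∈ O ∧ pair y b ∈ O ∧ ∃ q ∈ M, q = pair a b ∧ pair q c ∈ G) hkM hVM hO hGM hkM hkM)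
      (fun x hx => (mem_sep.1 hx).1)
  have memX : ∀ c, c ∈ ZFSet.sep (fun c => ∃ x ∈ V, ∃ y ∈ V, x ∈ y ∧ ∃ a ∈ κ, ∃ b ∈ κ,
      pair x a ∈ O ∧ pair y b ∈ O ∧ ∃ q ∈ M, q = pair a b ∧ pair q c ∈ G) κ ↔
      ∃ x ∈ V, ∃ y ∈ V, x ∈ y ∧ c = p (o x) (o y) := by
    intro c
    rw [mem_sep]
    constructor
    · rintro ⟨-, x, hx, y, hy, hxy, a, ha, b, hb, h1, h2, q, hq, rfl, h3⟩
      rw [hG a ha b hb] at h3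
      rw [((memO _ _).1 h1).2, ((memO _ _).1 h2).2] at h3
      exact ⟨x, hx, y, hy, hxy, h3⟩
    · rintro ⟨x, hx, y, hy, hxy, rfl⟩
      refine ⟨hpk _ (hok x hx) _ (hok y hy), x, hx, y, hy, hxy, o x, hok x hx, o y, hok y hy,
        (memO _ _).2 ⟨hx, rfl⟩, (memO _ _).2 ⟨hy, rfl⟩, _, ?_, rfl,
        (hG _ (hok x hx) _ (hok y hy) _).2 rfl⟩
      exact h.good.opair (h.good.tr _ hkM (hok x hx)) (h.good.tr _ hkM (hok y hy))
  generalize (ZFSet.sep (fun c => ∃ x ∈ V, ∃ y ∈ V, x ∈ y ∧ ∃ a ∈ κ, ∃ b ∈ κ,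
      pair x a ∈ O ∧ pair y b ∈ O ∧ ∃ q ∈ M, q = pair a b ∧ pair q c ∈ G) κ) = X at hX memX
  have hE : ZFSet.sep (fun z => ∃ c ∈ X, pair z c ∈ G) (κ.prod κ) ∈ N :=
    hN.sep (fun _ z X G _ _ _ => ∃ c ∈ X, pair z c ∈ G) (hN.prod hkN hkN) hX hGN' hX hX hX
  have memE : ∀ x ∈ V, ∀ y ∈ V, pair (o x) (o y) ∈
      ZFSet.sep (fun z => ∃ c ∈ X, pair z c ∈ G) (κ.prod κ) ↔ x ∈ y := by
    intro x hx y hy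
    rw [mem_sep]
    constructor
    · rintro ⟨-, c, hc, h1⟩
      rw [hG _ (hok x hx) _ (hok y hy)] at h1
      obtain ⟨x', hx', y', hy', hxy, h2⟩ := (memX c).1 hc
      obtain ⟨h3, h4⟩ := hpinj _ (hok x hx) _ (hok y hy) _ (hok x' hx') _ (hok y' hy')
        (h1.symm.trans h2)
      rwa [hoinj _ hx _ hx' h3, hoinj _ hy _ hy' h4]
    · intro hxy
      exact ⟨pair_mem_prod.2 ⟨hok x hx, hok y hy⟩, _, (memX _).2 ⟨x, hx, y, hy, hxy, rfl⟩,
        (hG _ (hok x hx) _ (hok y hy) _).2 rfl⟩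
  generalize (ZFSet.sep (fun z => ∃ c ∈ X, pair z c ∈ G) (κ.prod κ)) = E at hE memE
  have hinv : ∃ b : ZFSet.{u} → ZFSet.{u}, ∀ x ∈ V, b (o x) = x := by
    refine ⟨fun a => if h : ∃ x ∈ V, o x = a then h.choose else ∅, fun x hx => ?_⟩
    have h1 : ∃ y ∈ V, o y = o x := ⟨x, hx, rfl⟩
    dsimp only
    rw [dif_pos h1]
    exact hoinj _ h1.choose_spec.1 _ hx h1.choose_spec.2
  obtain ⟨b, hb⟩ := hinv
  have hcol : Col Y E b := by
    intro a ha z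
    obtain ⟨x, hx, rfl⟩ := (memY a).1 ha
    rw [hb x hx]
    constructor
    · intro hz
      have hzV := hVt _ hx hz
      exact ⟨o z, (memY _).2 ⟨z, hzV, rfl⟩, (memE _ hzV _ hx).2 hz, (hb z hzV).symm⟩
    · rintro ⟨c, hc, h1, rfl⟩
      obtain ⟨y, hy, rfl⟩ := (memY c).1 hc
      rw [hb y hy]
      exact (memE _ hy _ hx).1 h1
  obtain ⟨B, hB, hB'⟩ := mostowski hN hY hE hcol
  have memB : ∀ a x, pair a x ∈ B ↔ x ∈ V ∧ a = o x := by
    intro a x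
    rw [hB']
    constructor
    · rintro ⟨c, hc, e⟩
      obtain ⟨y, hy, rfl⟩ := (memY _).1 hc
      rw [hb y hy] at e
      obtain ⟨rfl, rfl⟩ := pair_inj.1 e
      exact ⟨hy, rfl⟩
    · rintro ⟨hx, rfl⟩
      exact ⟨o x, (memY _).2 ⟨x, hx, rfl⟩, by rw [hb x hx]⟩
  have hVN : V ∈ N := by
    obtain ⟨t, ht, h1⟩ := hN.repl (fun _ a x B _ _ _ _ => pair a x ∈ B) b hY hB hB hB hB
      (by
        intro a ha
        obtain ⟨x, hx, rfl⟩ := (memY _).1 ha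
        rw [hb x hx]
        exact Tr.pair_right hN.tr (hN.tr _ hB ((memB (o x) x).2 ⟨hx, rfl⟩)))
      (by
        intro a ha y _
        obtain ⟨x, hx, rfl⟩ := (memY _).1 ha
        rw [memB, hb x hx]
        constructor
        · rintro ⟨hy, e⟩
          exact hoinj _ hy _ hx e.symm
        · rintro rfl
          exact ⟨hx, rfl⟩)
    have : V = t := by
      ext x
      rw [h1]
      constructor
      · intro hx
        exact ⟨o x, (memY _).2 ⟨x, hx, rfl⟩, (hb x hx).symm⟩
      · rintro ⟨a, ha, rfl⟩
        obtain ⟨x, hx, rfl⟩ := (memY _).1 ha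
        rwa [hb x hx]
    rw [this]; exact ht
  have hVR : V ∈ R := by
    refine hR.surj κ hR.kR B hB V hVN ?_ ?_ hVt
    · intro a _ z _ w _ h1 h2
      rw [memB] at h1 h2
      exact hoinj _ h1.1 _ h2.1 (h1.2.symm.trans h2.2)
    · intro x hx
      exact ⟨o x, hok x hx, (memB _ _).2 ⟨hx, rfl⟩⟩
  refine ⟨hVR, ?_⟩
  -- subsets of `V` in `M` belong to `N`
  have subV : ∀ f ∈ M, f ⊆ V → ∃ A ∈ M, A ⊆ κ ∧ ∀ x ∈ V, x ∈ f ↔ o x ∈ A := by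
    intro f hf hfV
    refine ⟨_, h.good.sep (fun _ a f O _ _ _ => ∃ x ∈ f, pair x a ∈ O) hkM hf hO hO hO hO,
      fun x hx => (mem_sep.1 hx).1, fun x hx => ?_⟩
    rw [mem_sep]
    constructor
    · intro h1
      exact ⟨hok x hx, x, h1, (memO _ _).2 ⟨hx, rfl⟩⟩
    · rintro ⟨-, y, hy, h1⟩
      obtain ⟨h2, h3⟩ := (memO _ _).1 h1
      rwa [hoinj _ hx _ h2 h3]
  have codeN : ∀ A ∈ N, ZFSet.sep (fun x => ∃ a ∈ A, pair a x ∈ B) V ∈ N := fun A hA =>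
    hN.sep (fun _ x A B _ _ _ => ∃ a ∈ A, pair a x ∈ B) hVN hA hB hB hB hB
  obtain ⟨q, hq, hq'⟩ := hR.pw V hVR
  have hqN := hN.tr _ hR.RN hq
  have hF := hN.sep (fun _ f V U B κ _ => Fn V f ∧ ∃ A ∈ U,
    (∀ x ∈ V, x ∈ f ↔ ∃ a ∈ A, pair a x ∈ B) ∨
    (∀ x ∈ V, x ∈ f ↔ ∃ a ∈ κ, a ∉ A ∧ pair a x ∈ B)) hqN hVN hUN hB hkN hkN
  have memF : ∀ f, f ∈ ZFSet.sep (fun f => Fn V f ∧ ∃ A ∈ U,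
      (∀ x ∈ V, x ∈ f ↔ ∃ a ∈ A, pair a x ∈ B) ∨
      (∀ x ∈ V, x ∈ f ↔ ∃ a ∈ κ, a ∉ A ∧ pair a x ∈ B)) q ↔ f ∈ M ∧ Fn V f := by
    intro f
    rw [mem_sep]
    constructor
    · rintro ⟨-, h1, A, hA, h2⟩
      refine ⟨?_, h1⟩
      have hAM := (hU.1 A hA).1
      rcases h2 with h2 | h2
      · have h3 := h.good.sep (fun _ x A O _ _ _ => ∃ a ∈ A, pair x a ∈ O) hVM hAM hO hO hO hO
        convert h3 using 1
        ext x
        rw [mem_sep]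
        constructor
        · intro hx
          refine ⟨h1.1 hx, ?_⟩
          obtain ⟨a, ha, h4⟩ := (h2 x (h1.1 hx)).1 hx
          exact ⟨a, ha, (memO _ _).2 ((memB _ _).1 h4)⟩
        · rintro ⟨hx, a, ha, h4⟩
          exact (h2 x hx).2 ⟨a, ha, (memB _ _).2 ((memO _ _).1 h4)⟩
      · have h3 := h.good.sep (fun _ x A O κ _ _ => ∃ a ∈ κ, a ∉ A ∧ pair x a ∈ O)
          hVM hAM hO hkM hkM hkM
        convert h3 using 1
        ext x
        rw [mem_sep]
        constructor
        · intro hx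
          refine ⟨h1.1 hx, ?_⟩
          obtain ⟨a, ha, h5, h4⟩ := (h2 x (h1.1 hx)).1 hx
          exact ⟨a, ha, h5, (memO _ _).2 ((memB _ _).1 h4)⟩
        · rintro ⟨hx, a, ha, h5, h4⟩
          exact (h2 x hx).2 ⟨a, ha, h5, (memB _ _).2 ((memO _ _).1 h4)⟩
    · rintro ⟨hf, h1⟩
      obtain ⟨A, hA, hAk, h2⟩ := subV f hf h1.1
      have e1 : ∀ x ∈ V, x ∈ f ↔ ∃ a ∈ A, pair a x ∈ B := by
        intro x hx
        rw [h2 x hx]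
        constructor
        · intro h3
          exact ⟨_, h3, (memB _ _).2 ⟨hx, rfl⟩⟩
        · rintro ⟨a, ha, h3⟩
          rwa [← ((memB _ _).1 h3).2]
      refine ⟨hq' f ?_ h1.1, h1, ?_⟩
      · convert codeN A (sub A hA hAk) using 1
        ext x
        rw [mem_sep]
        exact ⟨fun hx => ⟨h1.1 hx, (e1 x (h1.1 hx)).1 hx⟩, fun hx => (e1 x hx.1).2 hx.2⟩
      · rcases hU.2.2.2.2.2.1 A hA hAk with h3 | h3
        · exact ⟨A, h3, Or.inl e1⟩
        · refine ⟨_, h3, Or.inr fun x hx => ?_⟩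
          rw [e1 x hx]
          refine exists_congr fun a => ?_
          rw [compl, mem_sep]
          constructor
          · rintro ⟨ha, h4⟩
            exact ⟨hAk ha, fun h5 => h5.2 ha, h4⟩
          · rintro ⟨ha, h5, h4⟩
            refine ⟨?_, h4⟩
            by_contra h6
            exact h5 ⟨ha, h6⟩
  refine ⟨_, hR.bdd V hVR _ hF (fun f hf => ?_), memF⟩
  exact ((memF f).1 hf).2.1

/-! ## The key lemma and the main theorem -/

theorem fapp_eq {f a b : ZFSet.{u}} (h : pair a b ∈ f) (hu : ∀ c, pair a c ∈ f → c = b) :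
    fapp f a = b := by
  have h1 : b ∈ (⋃₀ (⋃₀ f : ZFSet.{u}) : ZFSet.{u}) := by
    rw [mem_sUnion]
    refine ⟨{a, b}, mem_sUnion.2 ⟨_, h, by simp [pair]⟩, by simp⟩
  unfold fapp
  ext z
  rw [mem_sUnion]
  constructor
  · rintro ⟨c, hc, hz⟩
    rwa [← hu c (mem_sep.1 hc).2]
  · intro hz
    exact ⟨b, mem_sep.2 ⟨h1, h⟩, hz⟩

theorem KV.empty_mem {κ M : ZFSet.{u}} (h : KV κ M) : (∅ : ZFSet.{u}) ∈ κ := by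
  rw [← isOrdinal_empty.rank_lt_iff_mem h.ord, rank_empty]
  exact h.lim.bot_lt

theorem KV.k_mem {κ M U : ZFSet.{u}} (h : KV κ M) (hU : IsMUltrafilter κ M U) : κ ∈ U := by
  have h1 := hU.2.1 ∅ h.empty_mem
  convert h1 using 1
  ext x
  simp [tailSet]

theorem up_elem {κ M U N : ZFSet.{u}} {j : ZFSet.{u} → ZFSet.{u}} (h : KV κ M)
    (hj : IsUltrapowerEmb κ M U N j) : Elem M N j :=
  ⟨h.good.tr, hj.1, hj.2.1, hj.2.2.1⟩

theorem up_rr {κ M U N : ZFSet.{u}} {j : ZFSet.{u} → ZFSet.{u}} (h : KV κ M)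
    (hU : IsMUltrafilter κ M U) (hj : IsUltrapowerEmb κ M U N j) : RR κ N (j (V_ κ.rank)) :=
  h.rr (up_elem h hj) ((hj.2.2.2.2 κ h.kM (fun _ hx => hx)).1 (h.k_mem hU))

theorem key {κ M U N' N R : ZFSet.{u}} {j : ZFSet.{u} → ZFSet.{u}} (h : KV κ M)
    (hU : IsMUltrafilter κ M U) (hj : IsUltrapowerEmb κ M U N' j) (hR : RR κ N R) (hUN : U ∈ N) :
    j (V_ κ.rank) ∈ R := by
  have hR' := up_rr h hU hj
  have he := up_elem h hj
  have hkj : κ ∈ j κ := (hj.2.2.2.2 κ h.kM (fun _ hx => hx)).1 (h.k_mem hU)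
  obtain ⟨hVR, F, hFR, hF⟩ := functions_mem h hU hR hUN
  have hN := hR.good
  have hVM := h.VM
  have hkM := h.kM
  have hkN' : κ ∈ N' := hR'.good.tr _ hR'.RN hR'.kR
  have hFN := hN.tr _ hR.RN hFR
  have hVN := hN.tr _ hR.RN hVR
  set V := V_ κ.rank with hVdef
  set R' := j V with hR'def
  have hkV : κ ⊆ V := h.k_sub
  have hRt : R'.IsTransitive := hR'.tr
  -- basic facts on members of `F`
  have jfn : ∀ f ∈ F, Fn R' (j f) := fun f hf =>
    (he.elem (fun _ V f _ _ _ => Fn V f) hVM ((hF f).1 hf).1 hVM hVM hVM).1 ((hF f).1 hf).2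
  have juniq : ∀ f ∈ F, ∀ y z, pair κ y ∈ j f → pair κ z ∈ j f → y = z := by
    intro f hf y z hy hz
    have h1 := jfn f hf
    exact h1.2 κ hR'.kR y (Tr.pair_right hRt (h1.1 hy)) z (Tr.pair_right hRt (h1.1 hz)) hy hz
  have hval : ∃ val : ZFSet.{u} → ZFSet.{u}, ∀ f,
      ((∃ y, pair κ y ∈ j f) → pair κ (val f) ∈ j f) ∧
      ((¬ ∃ y, pair κ y ∈ j f) → val f = ∅) := by
    refine ⟨fun f => if h : ∃ y, pair κ y ∈ j f then h.choose else ∅, fun f => ⟨?_, ?_⟩⟩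
    · intro h1
      simp only [dif_pos h1]
      exact h1.choose_spec
    · intro h1
      simp only [dif_neg h1]
  obtain ⟨val, hval⟩ := hval
  have val_eq : ∀ f ∈ F, ∀ y, pair κ y ∈ j f → val f = y := fun f hf y hy =>
    juniq f hf _ _ ((hval f).1 ⟨y, hy⟩) hy
  have valR : ∀ f ∈ F, val f ∈ R' := by
    intro f hf
    by_cases h1 : ∃ y, pair κ y ∈ j f
    · exact Tr.pair_right hRt ((jfn f hf).1 ((hval f).1 h1))
    · rw [(hval f).2 h1]
      exact hR'.tr _ hR'.kR h.empty_mem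
  have val_surj : ∀ z ∈ R', ∃ f ∈ F, pair κ z ∈ j f := by
    intro z hz
    obtain ⟨t, htM, ht, -, hz'⟩ := hj.2.2.2.1 z (hR'.good.tr _ hR'.RN hz)
    change t ∈ M at htM
    have h1 : ∀ a ∈ κ, ∃ b ∈ M, pair a b ∈ t ∧ ∀ c ∈ M, pair a c ∈ t → c = b := by
      intro a ha
      obtain ⟨b, hb, hu⟩ := ht.2 a ha
      exact ⟨b, Tr.pair_right h.good.tr (h.good.tr _ htM hb), hb, fun c _ hc => hu c hc⟩
    obtain ⟨b, hb, hbt, hbu⟩ := (he.elem (fun M κ t _ _ _ => ∀ a ∈ κ, ∃ b ∈ M, pair a b ∈ t ∧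
      ∀ c ∈ M, pair a c ∈ t → c = b) hkM htM hkM hkM hkM).1 h1 κ hkj
    have h2 : fapp (j t) κ = b := fapp_eq hbt (fun c hc =>
      hbu c (Tr.pair_right hR'.good.tr (hR'.good.tr _ (he.maps _ htM) hc)) hc)
    have hbz : b = z := h2.symm.trans hz'
    subst hbz
    have hg := h.good.sep (fun _ x t _ _ _ _ => x ∈ t) hVM htM htM htM htM htM
    have hgm : ∀ w ∈ M, w ∈ ZFSet.sep (fun x => x ∈ t) V ↔ w ∈ V ∧ w ∈ t := fun w _ => mem_sep
    have hgF : ZFSet.sep (fun x => x ∈ t) V ∈ F := by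
      refine (hF _).2 ⟨hg, fun x hx => (mem_sep.1 hx).1, ?_⟩
      intro x _ y _ w _ h3 h4
      have h3 := (mem_sep.1 h3).2
      have h4 := (mem_sep.1 h4).2
      obtain ⟨a, ha, c, e⟩ := ht.1 _ h3
      obtain ⟨rfl, rfl⟩ := pair_inj.1 e
      exact (ht.2 x ha).unique h3 h4
    refine ⟨_, hgF, ?_⟩
    have h5 := (he.elem (fun M g V t _ _ => ∀ w ∈ M, w ∈ g ↔ w ∈ V ∧ w ∈ t)
      hg hVM htM htM htM).1 hgm
    obtain ⟨q, hq, rfl⟩ := hR'.pr κ hR'.kR b hz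
    exact (h5 _ (hR'.good.tr _ hR'.RN hq)).2 ⟨hq, hbt⟩
  -- the membership relation of the ultrapower
  have hE := hN.sep (fun _ z F U V _ _ => ∃ g ∈ F, ∃ f ∈ F, z = pair g f ∧ ∃ A ∈ U, ∀ ξ ∈ A,
    ∃ y ∈ V, ∃ w ∈ V, pair ξ y ∈ g ∧ pair ξ w ∈ f ∧ y ∈ w) (hN.prod hFN hFN) hFN hUN hVN hVN hVN
  have memE : ∀ g ∈ F, ∀ f ∈ F, pair g f ∈ ZFSet.sep (fun z => ∃ g ∈ F, ∃ f ∈ F, z = pair g f ∧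
      ∃ A ∈ U, ∀ ξ ∈ A, ∃ y ∈ V, ∃ w ∈ V, pair ξ y ∈ g ∧ pair ξ w ∈ f ∧ y ∈ w) (F.prod F) ↔
      ∃ y ∈ R', ∃ w ∈ R', pair κ y ∈ j g ∧ pair κ w ∈ j f ∧ y ∈ w := by
    intro g hg f hf
    have hgM := ((hF g).1 hg).1
    have hfM := ((hF f).1 hf).1
    have hS := h.good.sep (fun _ ξ V g f _ _ => ∃ y ∈ V, ∃ w ∈ V, pair ξ y ∈ g ∧ pair ξ w ∈ f ∧
      y ∈ w) hkM hVM hgM hfM hfM hfM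
    have hSm : ∀ ξ ∈ M, ξ ∈ ZFSet.sep (fun ξ => ∃ y ∈ V, ∃ w ∈ V, pair ξ y ∈ g ∧ pair ξ w ∈ f ∧
      y ∈ w) κ ↔ ξ ∈ κ ∧ ∃ y ∈ V, ∃ w ∈ V, pair ξ y ∈ g ∧ pair ξ w ∈ f ∧ y ∈ w :=
      fun ξ _ => mem_sep
    have hSk : ZFSet.sep (fun ξ => ∃ y ∈ V, ∃ w ∈ V, pair ξ y ∈ g ∧ pair ξ w ∈ f ∧
      y ∈ w) κ ⊆ κ := fun x hx => (mem_sep.1 hx).1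
    generalize (ZFSet.sep (fun ξ => ∃ y ∈ V, ∃ w ∈ V, pair ξ y ∈ g ∧ pair ξ w ∈ f ∧
      y ∈ w) κ) = S at hS hSm hSk
    have h1 := (he.elem (fun M S κ V g f => ∀ ξ ∈ M, ξ ∈ S ↔ ξ ∈ κ ∧ ∃ y ∈ V, ∃ w ∈ V,
      pair ξ y ∈ g ∧ pair ξ w ∈ f ∧ y ∈ w) hS hkM hVM hgM hfM).1 hSm κ hkN'
    have h2 : κ ∈ j S ↔ ∃ y ∈ R', ∃ w ∈ R', pair κ y ∈ j g ∧ pair κ w ∈ j f ∧ y ∈ w :=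
      ⟨fun h3 => (h1.1 h3).2, fun h3 => h1.2 ⟨hkj, h3⟩⟩
    rw [← h2, ← hj.2.2.2.2 S hS hSk, mem_sep]
    constructor
    · rintro ⟨-, g', hg', f', hf', e, A, hA, h3⟩
      obtain ⟨rfl, rfl⟩ := pair_inj.1 e
      refine hU.2.2.2.2.1 A hA S hS hSk (fun ξ hξ => ?_)
      have h4 := (hU.1 A hA).2 hξ
      exact (hSm ξ (h.good.tr _ hkM h4)).2 ⟨h4, h3 ξ hξ⟩
    · intro h3
      exact ⟨pair_mem_prod.2 ⟨hg, hf⟩, g, hg, f, hf, rfl, S, h3, fun ξ hξ =>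
        ((hSm ξ (h.good.tr _ hS hξ)).1 hξ).2⟩
  generalize (ZFSet.sep (fun z => ∃ g ∈ F, ∃ f ∈ F, z = pair g f ∧
      ∃ A ∈ U, ∀ ξ ∈ A, ∃ y ∈ V, ∃ w ∈ V, pair ξ y ∈ g ∧ pair ξ w ∈ f ∧ y ∈ w)
      (F.prod F)) = E at hE memE
  have hcol : Col F E val := by
    intro f hf z
    constructor
    · intro hz
      have h1 : ∃ y, pair κ y ∈ j f := by
        by_contra h1
        rw [(hval f).2 h1] at hz
        exact notMem_empty _ hz
      have h2 := (hval f).1 h1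
      have hzR := hR'.tr _ (valR f hf) hz
      obtain ⟨g, hg, h3⟩ := val_surj z hzR
      exact ⟨g, hg, (memE g hg f hf).2 ⟨z, hzR, _, valR f hf, h3, h2, hz⟩, (val_eq g hg z h3).symm⟩
    · rintro ⟨g, hg, h1, rfl⟩
      obtain ⟨y, _, w, _, h2, h3, h4⟩ := (memE g hg f hf).1 h1
      rwa [val_eq g hg y h2, val_eq f hf w h3]
  obtain ⟨G, hG, hG'⟩ := mostowski hN hFN hE hcol
  have memG : ∀ f y, pair f y ∈ G ↔ f ∈ F ∧ y = val f := by
    intro f y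
    rw [hG']
    constructor
    · rintro ⟨x, hx, e⟩
      obtain ⟨rfl, rfl⟩ := pair_inj.1 e
      exact ⟨hx, rfl⟩
    · rintro ⟨hx, rfl⟩
      exact ⟨f, hx, rfl⟩
  have hR'N : R' ∈ N := by
    obtain ⟨t, ht, h1⟩ := hN.repl (fun _ f y G _ _ _ _ => pair f y ∈ G) val hFN hG hG hG hG
      (fun f hf => Tr.pair_right hN.tr (hN.tr _ hG ((memG f _).2 ⟨hf, rfl⟩)))
      (fun f hf y _ => by rw [memG]; exact ⟨fun h2 => h2.2, fun h2 => ⟨hf, h2⟩⟩)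
    have : R' = t := by
      ext z
      rw [h1]
      constructor
      · intro hz
        obtain ⟨f, hf, h2⟩ := val_surj z hz
        exact ⟨f, hf, (val_eq f hf z h2).symm⟩
      · rintro ⟨f, hf, rfl⟩
        exact valR f hf
    rw [this]; exact ht
  refine hR.surj F hFR G hG R' hR'N ?_ ?_ hR'.tr
  · intro f _ z _ w _ h1 h2
    rw [((memG _ _).1 h1).2, ((memG _ _).1 h2).2]
  · intro z hz
    obtain ⟨f, hf, h2⟩ := val_surj z hz
    exact ⟨f, hf, (memG _ _).2 ⟨hf, (val_eq f hf z h2).symm⟩⟩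

theorem mu_spec {κ U : ZFSet.{u}} (hU : IsRamseyMeasure κ U) : IsMUModel κ U (MU κ U) := by
  have h := hU.1.2.2
  unfold MU
  rw [dif_pos h]
  exact h.choose_spec

theorem nu_spec {κ U A : ZFSet.{u}} (hA : A ∈ NU κ U) :
    IsUltrapowerEmb κ (MU κ U) U (NU κ U) (jU κ U) := by
  unfold NU jU
  unfold NU at hA
  by_cases h : ∃ p : ZFSet.{u} × (ZFSet.{u} → ZFSet.{u}), IsUltrapowerEmb κ (MU κ U) U p.1 p.2
  · have e : upData κ U = h.choose := by
      unfold upData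
      rw [dif_pos h]
    rw [e]
    exact h.choose_spec
  · have e : upData κ U = (∅, id) := by
      unfold upData
      rw [dif_neg h]
    rw [e] at hA
    exact absurd hA (notMem_empty _)

theorem mu_kv {κ U : ZFSet.{u}} (hκ : IsCard κ) (hU : IsRamseyMeasure κ U) : KV κ (MU κ U) :=
  kv_of hκ (mu_spec hU).1 (mu_spec hU).2.1

theorem nu_rr {κ U A : ZFSet.{u}} (hκ : IsCard κ) (hU : IsRamseyMeasure κ U) (hA : A ∈ NU κ U) :
    RR κ (NU κ U) (jU κ U (V_ κ.rank)) :=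
  up_rr (mu_kv hκ hU) (mu_spec hU).2.2.1 (nu_spec hA)

/-- If `A ∈ N_U` and `U ∈ N_W` then `j_U(V_κ) ∈ j_W(V_κ)`. -/
theorem order_step {κ U W A : ZFSet.{u}} (hκ : IsCard κ) (hU : IsRamseyMeasure κ U)
    (hW : IsRamseyMeasure κ W) (hA : A ∈ NU κ U) (hUW : U ∈ NU κ W) :
    jU κ U (V_ κ.rank) ∈ jU κ W (V_ κ.rank) :=
  key (mu_kv hκ hU) (mu_spec hU).2.2.1 (nu_spec hA) (nu_rr hκ hW hUW) hUW

theorem order_acc {κ : ZFSet.{u}} (hκ : IsCard κ) :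
    ∀ m W : ZFSet.{u}, jU κ W (V_ κ.rank) = m → Acc (ramseyMeasureOrder κ) W := by
  intro m
  induction m using ZFSet.inductionOn with
  | _ m ih =>
    rintro W rfl
    refine Acc.intro W fun U hUW => ?_
    by_cases h : ∃ A, ramseyMeasureOrder κ A U
    · obtain ⟨A, hA⟩ := h
      exact ih _ (order_step hκ hUW.1 hUW.2.1 hA.2.2 hUW.2.2) U rfl
    · exact Acc.intro U fun A hA => absurd ⟨A, hA⟩ h

/-- The relation `◁` on Ramsey measures on a cardinal `κ`, defined by
`U ◁ W` iff `U ∈ N_W`, is transitive and well-founded. -/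
theorem ramseyMeasureOrder_transitive_wellFounded (κ : ZFSet) (hκ : IsCard κ) :
    Transitive (ramseyMeasureOrder κ) ∧ WellFounded (ramseyMeasureOrder κ) := by
  refine ⟨?_, ⟨fun W => order_acc hκ _ W rfl⟩⟩
  intro A U W hAU hUW
  refine ⟨hAU.1, hUW.2.1, ?_⟩
  have h1 := order_step hκ hUW.1 hUW.2.1 hAU.2.2 hUW.2.2
  have hRU := nu_rr hκ hUW.1 hAU.2.2
  have hRW := nu_rr hκ hUW.2.1 hUW.2.2
  have h2 := hRU.bdd κ hRU.kR A hAU.2.2 hAU.1.1.2.1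
  exact hRW.good.tr _ hRW.RN (hRW.tr _ h1 h2)

end MPaper
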